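/- arXiv:2405.05756 — 3 statements merged into one kernel-verified Lean document; each statement's English description precedes it below -/
import Mathlib

section
/- (Gleason's theorem, as used in Theorem 3.1.) Let H be a separable complex Hilbert space with dim(H) ≥ 3 (possibly infinite). For every Intensive State of Affairs Ψ on H there exists a unique positive self-adjoint trace-class operator ρ with Tr(ρ) = 1 such that Ψ(P) = Tr(ρP) for every orthogonal projection P on H. Hence positive self-adjoint trace-class operators of trace 1 are in bijective correspondence with Intensive States of Affairs. -/
open scoped ComplexInnerProductSpace

/-- `P` is an orthogonal projection: a self-adjoint idempotent bounded operator. -/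
def IsProjection {H : Type*} [NormedAddCommGroup H] [InnerProductSpace ℂ H] [CompleteSpace H]
    (P : H →L[ℂ] H) : Prop :=
  IsSelfAdjoint P ∧ P ∘L P = P

/-- An Intensive State of Affairs (ISA): a map assigning to every orthogonal projection a value
in `[0,1]`, with `Ψ 1 = 1`, that is countably additive on pairwise orthogonal families of
projections whose sum converges strongly to a projection. -/
def IsISA {H : Type*} [NormedAddCommGroup H] [InnerProductSpace ℂ H] [CompleteSpace H]
    (Ψ : (H →L[ℂ] H) → ℝ) : Prop :=
  (∀ P : H →L[ℂ] H, IsProjection P → Ψ P ∈ Set.Icc (0 : ℝ) 1) ∧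
  Ψ 1 = 1 ∧
  ∀ (P : ℕ → H →L[ℂ] H) (Q : H →L[ℂ] H),
    (∀ i, IsProjection (P i)) → IsProjection Q →
    (∀ i j, i ≠ j → P i ∘L P j = 0) →
    (∀ x : H, HasSum (fun i => P i x) (Q x)) →
    HasSum (fun i => Ψ (P i)) (Ψ Q)

/-- The vector of `ℝ³` with given coordinates. -/
def vec (a b c : ℝ) : EuclideanSpace ℝ (Fin 3) := !₂[a, b, c]

@[simp] lemma vec_zero_apply (a b c : ℝ) : vec a b c 0 = a := rfl
@[simp] lemma vec_one_apply (a b c : ℝ) : vec a b c 1 = b := rfl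
@[simp] lemma vec_two_apply (a b c : ℝ) : vec a b c 2 = c := rfl

lemma vec_eta (x : EuclideanSpace ℝ (Fin 3)) : vec (x 0) (x 1) (x 2) = x := by
  ext i; fin_cases i <;> rfl

lemma smul_vec (t a b c : ℝ) : t • vec a b c = vec (t * a) (t * b) (t * c) := by
  ext i; fin_cases i <;> simp [vec]

lemma inner_vec (a b c a' b' c' : ℝ) :
    inner ℝ (vec a b c) (vec a' b' c') = a * a' + b * b' + c * c' := by
  simp [vec, PiLp.inner_apply, Fin.sum_univ_three]; ring

lemma norm_sq_vec (a b c : ℝ) : ‖vec a b c‖ ^ 2 = a ^ 2 + b ^ 2 + c ^ 2 := by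
  rw [← real_inner_self_eq_norm_sq, inner_vec]; ring

lemma vec_ne_zero_iff (a b c : ℝ) : vec a b c ≠ 0 ↔ 0 < a ^ 2 + b ^ 2 + c ^ 2 := by
  rw [← norm_sq_vec, ← norm_pos_iff]
  exact ⟨fun h => by positivity, fun h => by
    rcases (norm_nonneg (vec a b c)).eq_or_lt with h0 | h0
    · rw [← h0] at h; norm_num at h
    · exact h0⟩

lemma continuous_vec {X : Type*} [TopologicalSpace X] {u v w : X → ℝ} (hu : Continuous u)
    (hv : Continuous v) (hw : Continuous w) : Continuous fun x => vec (u x) (v x) (w x) := by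
  unfold vec
  refine (PiLp.continuous_toLp 2 _).comp (continuous_pi fun i => ?_)
  fin_cases i <;> simpa

/-- A frame function of weight `w` on `ℝ³`, seen as a function on lines: its values on
the three axes of any orthogonal frame add up to `w`. -/
structure IsFrame (f : EuclideanSpace ℝ (Fin 3) → ℝ) (w : ℝ) : Prop where
  smul : ∀ (t : ℝ) x, t ≠ 0 → f (t • x) = f x
  sum : ∀ x y z, x ≠ 0 → y ≠ 0 → z ≠ 0 → inner ℝ x y = 0 → inner ℝ x z = 0 → inner ℝ y z = 0 →
    f x + f y + f z = w

/-- The quarter turn about the third axis. -/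
noncomputable def quarterTurn : EuclideanSpace ℝ (Fin 3) →ₗᵢ[ℝ] EuclideanSpace ℝ (Fin 3) where
  toFun x := vec (-x 1) (x 0) (x 2)
  map_add' x y := by ext i; fin_cases i <;> simp [vec]; ring
  map_smul' t x := by ext i; fin_cases i <;> simp [vec]
  norm_map' x := by
    rw [← sq_eq_sq₀ (norm_nonneg _) (norm_nonneg _)]
    conv_rhs => rw [← vec_eta x, norm_sq_vec]
    exact (norm_sq_vec _ _ _).trans (by ring)

lemma quarterTurn_vec (a b c : ℝ) : quarterTurn (vec a b c) = vec (-b) a c := rfl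

namespace IsFrame

variable {f g : EuclideanSpace ℝ (Fin 3) → ℝ} {w w' : ℝ}

lemma comp (hf : IsFrame f w) (A : EuclideanSpace ℝ (Fin 3) →ₗᵢ[ℝ] EuclideanSpace ℝ (Fin 3)) :
    IsFrame (fun x => f (A x)) w where
  smul t x ht := by simp only [map_smul]; exact hf.smul t _ ht
  sum x y z hx hy hz hxy hxz hyz :=
    hf.sum _ _ _ ((map_ne_zero_iff A A.injective).2 hx)
      ((map_ne_zero_iff A A.injective).2 hy) ((map_ne_zero_iff A A.injective).2 hz)
      (by simpa using hxy) (by simpa using hxz) (by simpa using hyz)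

lemma add (hf : IsFrame f w) (hg : IsFrame g w') : IsFrame (fun x => f x + g x) (w + w') where
  smul t x ht := by rw [hf.smul t x ht, hg.smul t x ht]
  sum x y z hx hy hz hxy hxz hyz := by
    have h1 := hf.sum x y z hx hy hz hxy hxz hyz
    have h2 := hg.sum x y z hx hy hz hxy hxz hyz
    linarith

lemma neg (hf : IsFrame f w) : IsFrame (fun x => -f x) (-w) where
  smul t x ht := by rw [hf.smul t x ht]
  sum x y z hx hy hz hxy hxz hyz := by
    have h1 := hf.sum x y z hx hy hz hxy hxz hyz
    linarith

lemma const (m : ℝ) : IsFrame (fun _ => m) (3 * m) where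
  smul _ _ _ := rfl
  sum _ _ _ _ _ _ _ _ _ := by ring

lemma sum_vec (hf : IsFrame f w) {a b c a' b' c' a'' b'' c'' : ℝ}
    (h : 0 < a ^ 2 + b ^ 2 + c ^ 2) (h' : 0 < a' ^ 2 + b' ^ 2 + c' ^ 2)
    (h'' : 0 < a'' ^ 2 + b'' ^ 2 + c'' ^ 2) (h1 : a * a' + b * b' + c * c' = 0)
    (h2 : a * a'' + b * b'' + c * c'' = 0) (h3 : a' * a'' + b' * b'' + c' * c'' = 0) :
    f (vec a b c) + f (vec a' b' c') + f (vec a'' b'' c'') = w :=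
  hf.sum _ _ _ ((vec_ne_zero_iff _ _ _).2 h) ((vec_ne_zero_iff _ _ _).2 h')
    ((vec_ne_zero_iff _ _ _).2 h'') (by rwa [inner_vec]) (by rwa [inner_vec]) (by rwa [inner_vec])

lemma smul_vec (hf : IsFrame f w) {t : ℝ} (ht : t ≠ 0) (a b c : ℝ) :
    f (vec (t * a) (t * b) (t * c)) = f (vec a b c) := by
  rw [← _root_.smul_vec, hf.smul _ _ ht]

lemma vec_div (hf : IsFrame f w) {c : ℝ} (hc : c ≠ 0) (a b : ℝ) :
    f (vec (a / c) (b / c) 1) = f (vec a b c) := by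
  rw [← hf.smul_vec hc, mul_div_cancel₀ _ hc, mul_div_cancel₀ _ hc, mul_one]

lemma pole (hf : IsFrame f w) {c : ℝ} (hc : c ≠ 0) : f (vec 0 0 c) = f (vec 0 0 1) := by
  simpa using (hf.vec_div hc 0 0).symm

end IsFrame

/-- A frame function that takes the value `c` on the whole equator, and `T` at the pole. -/
structure IsPolarFrame (g : EuclideanSpace ℝ (Fin 3) → ℝ) (T c : ℝ) : Prop where
  frame : IsFrame g (T + 2 * c)
  equator : ∀ a b, 0 < a ^ 2 + b ^ 2 → g (vec a b 0) = c
  north : g (vec 0 0 1) = T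

lemma IsFrame.isPolarFrame {f : EuclideanSpace ℝ (Fin 3) → ℝ} {w : ℝ} (hf : IsFrame f w) :
    IsPolarFrame (fun x => f x + f (quarterTurn x)) (2 * f (vec 0 0 1)) (w - f (vec 0 0 1)) where
  frame := by
    have := hf.add (hf.comp quarterTurn)
    convert this using 1
    ring
  equator a b h := by
    have := hf.sum_vec (a := a) (b := b) (c := 0) (a' := -b) (b' := a) (c' := 0) (a'' := 0)
      (b'' := 0) (c'' := 1) (by simpa using h) (by nlinarith) (by norm_num) (by ring) (by ring)
      (by ring)
    rw [quarterTurn_vec]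
    linarith
  north := by
    rw [quarterTurn_vec]; simp; ring

namespace IsPolarFrame

variable {g : EuclideanSpace ℝ (Fin 3) → ℝ} {T c : ℝ}

lemma partner (hg : IsPolarFrame g T c) {a b : ℝ} (h : 0 < a ^ 2 + b ^ 2) (z : ℝ) :
    g (vec a b z) + g (vec (a * z) (b * z) (-(a ^ 2 + b ^ 2))) = T + c := by
  have h1 := hg.frame.sum_vec (a := a) (b := b) (c := z) (a' := a * z) (b' := b * z)
    (c' := -(a ^ 2 + b ^ 2)) (a'' := -b) (b'' := a) (c'' := 0) (by positivity)
    (by nlinarith [pow_pos h 2, sq_nonneg (a * z), sq_nonneg (b * z)]) (by nlinarith)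
    (by ring) (by ring) (by ring)
  have h2 := hg.equator (-b) a (by nlinarith)
  linarith

lemma descent (hg : IsPolarFrame g T c) {x y : ℝ} (h : 0 < x ^ 2 + y ^ 2) (t : ℝ) :
    ∃ v ≠ 0, g (vec x y 1) + c = g (vec (x - t * y) (y + t * x) 1) + g v := by
  set r := x ^ 2 + y ^ 2 with hr
  have h1 := hg.frame.sum_vec (a := x) (b := y) (c := 1) (a' := -y) (b' := x)
    (c' := 0) (a'' := x) (b'' := y) (c'' := -r) (by positivity) (by nlinarith)
    (by positivity) (by ring) (by rw [hr]; ring) (by ring)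
  have hv : 0 < (t * r * x + (r + 1) * y) ^ 2 + (t * r * y - (r + 1) * x) ^ 2 + (t * r) ^ 2 := by
    have : (t * r * x + (r + 1) * y) ^ 2 + (t * r * y - (r + 1) * x) ^ 2 =
        (t ^ 2 * r ^ 2 + (r + 1) ^ 2) * r := by rw [hr]; ring
    rw [this]; positivity
  have h2 := hg.frame.sum_vec (a := x - t * y) (b := y + t * x) (c := 1)
    (a' := t * r * x + (r + 1) * y) (b' := t * r * y - (r + 1) * x)
    (c' := t * r) (a'' := x) (b'' := y) (c'' := -r) (by positivity) hv
    (by positivity) (by rw [hr]; ring) (by rw [hr]; ring) (by rw [hr]; ring)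
  have h3 := hg.equator (-y) x (by nlinarith)
  exact ⟨_, (vec_ne_zero_iff _ _ _).2 hv, by linarith⟩

lemma split (hg : IsPolarFrame g T c) {x y : ℝ} (h : 0 < x ^ 2 + y ^ 2) :
    ∃ a b a' b', 0 < a ^ 2 + b ^ 2 ∧ 0 < a' ^ 2 + b' ^ 2 ∧
      g (vec x y 1) + T = g (vec a b 1) + g (vec a' b' 1) := by
  set r := x ^ 2 + y ^ 2 with hr
  obtain ⟨k, hk⟩ : ∃ k : ℝ, k ^ 2 = 1 + r := ⟨√(1 + r), Real.sq_sqrt (by positivity)⟩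
  have hu : (x - k * y) ^ 2 + (y + k * x) ^ 2 = r * (2 + r) := by
    linear_combination r * hk - (1 + k ^ 2) * hr
  have hv : (x + k * y) ^ 2 + (y - k * x) ^ 2 = r * (2 + r) := by
    linear_combination r * hk - (1 + k ^ 2) * hr
  have hpos : 0 < r * (2 + r) := by positivity
  have h1 := hg.frame.sum_vec (a := x) (b := y) (c := 1) (a' := x - k * y) (b' := y + k * x)
    (c' := -r) (a'' := x + k * y) (b'' := y - k * x) (c'' := -r) (by positivity)
    (by nlinarith) (by nlinarith) (by rw [hr]; ring) (by rw [hr]; ring)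
    (by linear_combination (-r) * hk - (1 - k ^ 2) * hr)
  have h2 := hg.partner (a := x - k * y) (b := y + k * x) (by rw [hu]; exact hpos) (-r)
  have h3 := hg.partner (a := x + k * y) (b := y - k * x) (by rw [hv]; exact hpos) (-r)
  rw [hu, ← hg.frame.vec_div (c := -(r * (2 + r))) (by nlinarith)] at h2
  rw [hv, ← hg.frame.vec_div (c := -(r * (2 + r))) (by nlinarith)] at h3
  have key : ∀ a b : ℝ, a ^ 2 + b ^ 2 = r * (2 + r) →
      0 < (a * -r / -(r * (2 + r))) ^ 2 + (b * -r / -(r * (2 + r))) ^ 2 := by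
    intro a b hab
    have h0 : -r / -(r * (2 + r)) ≠ 0 := div_ne_zero (by nlinarith) (by nlinarith)
    have : 0 < (-r / -(r * (2 + r))) ^ 2 * (a ^ 2 + b ^ 2) := by rw [hab]; positivity
    convert this using 1
    ring
  exact ⟨_, _, _, _, key _ _ hu, key _ _ hv, by linear_combination h1 - h2 - h3⟩

lemma le_add (hg : IsPolarFrame g T c) (h0 : ∀ v ≠ 0, 0 ≤ g v) {v : EuclideanSpace ℝ (Fin 3)}
    (hv : v ≠ 0) : g v ≤ c + T := by
  have hc : 0 ≤ c := by
    rw [← hg.equator 1 0 (by norm_num)]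
    exact h0 _ ((vec_ne_zero_iff _ _ _).2 (by norm_num))
  rw [← vec_eta v] at hv ⊢
  generalize v 0 = a at *
  generalize v 1 = b at *
  generalize v 2 = z at *
  rw [vec_ne_zero_iff] at hv
  by_cases h : 0 < a ^ 2 + b ^ 2
  · have h1 := hg.partner h z
    have h2 := h0 (vec (a * z) (b * z) (-(a ^ 2 + b ^ 2))) ((vec_ne_zero_iff _ _ _).2
      (by nlinarith [pow_pos h 2, sq_nonneg (a * z), sq_nonneg (b * z)]))
    linarith
  · have ha : a = 0 := by nlinarith
    have hb : b = 0 := by nlinarith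
    subst ha hb
    rw [hg.frame.pole (by rintro rfl; norm_num at hv), hg.north]
    linarith

lemma le_descent (hg : IsPolarFrame g T c) (h0 : ∀ v ≠ 0, 0 ≤ g v) {x y : ℝ}
    (h : 0 < x ^ 2 + y ^ 2) (t : ℝ) :
    g (vec x y 1) ≤ g (vec (x - t * y) (y + t * x) 1) + T := by
  obtain ⟨v, hv, h1⟩ := hg.descent h t
  linarith [hg.le_add h0 hv]

lemma exists_lt (hg : IsPolarFrame g T c) {η : ℝ} (hη : 0 < η) :
    ∃ x y, 0 < x ^ 2 + y ^ 2 ∧ g (vec x y 1) < T + η := by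
  by_contra! hcon
  set S : Set ℝ := {u | ∃ x y, 0 < x ^ 2 + y ^ 2 ∧ g (vec x y 1) = u} with hS
  have hne : S.Nonempty := ⟨_, 1, 0, by norm_num, rfl⟩
  have hbd : BddBelow S := ⟨T + η, by rintro _ ⟨x, y, h, rfl⟩; exact hcon x y h⟩
  have hle : T + η ≤ sInf S := le_csInf hne (by rintro _ ⟨x, y, h, rfl⟩; exact hcon x y h)
  obtain ⟨_, ⟨x, y, h, rfl⟩, hlt⟩ := exists_lt_of_csInf_lt hne (lt_add_of_pos_right (sInf S) hη)
  obtain ⟨a, b, a', b', h1, h2, h3⟩ := hg.split h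
  have h4 : sInf S ≤ g (vec a b 1) := csInf_le hbd ⟨a, b, h1, rfl⟩
  have h5 : sInf S ≤ g (vec a' b' 1) := csInf_le hbd ⟨a', b', h2, rfl⟩
  linarith

lemma eventually_le (hg : IsPolarFrame g T c) (h0 : ∀ v ≠ 0, 0 ≤ g v) {η : ℝ} (hη : 0 < η) :
    ∃ v₀ ≠ 0, ∀ᶠ v in nhds v₀, g v ≤ 3 * T + η := by
  obtain ⟨x, y, hxy, hlt⟩ := hg.exists_lt hη
  refine ⟨vec (x / 4) (y / 4) 1, (vec_ne_zero_iff _ _ _).2 (by positivity), ?_⟩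
  have hc0 : Continuous fun v : EuclideanSpace ℝ (Fin 3) => v 0 := by fun_prop
  have hc1 : Continuous fun v : EuclideanSpace ℝ (Fin 3) => v 1 := by fun_prop
  have hc2 : Continuous fun v : EuclideanSpace ℝ (Fin 3) => v 2 := by fun_prop
  have e1 : ∀ᶠ v in nhds (vec (x / 4) (y / 4) 1), v 2 ≠ 0 :=
    hc2.continuousAt.eventually_ne (by simp)
  have e2 : ∀ᶠ v in nhds (vec (x / 4) (y / 4) 1), 0 < v 0 ^ 2 + v 1 ^ 2 := by
    refine ContinuousAt.eventually_lt continuousAt_const (by fun_prop) ?_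
    simp only [vec_zero_apply, vec_one_apply]
    nlinarith
  have e3 : ∀ᶠ v in nhds (vec (x / 4) (y / 4) 1),
      4 * (v 0 ^ 2 + v 1 ^ 2) ^ 2 <
        (v 2 * (y * v 0 - x * v 1)) ^ 2 +
          4 * (v 2 * (x * v 0 + y * v 1)) * (v 0 ^ 2 + v 1 ^ 2) := by
    refine ContinuousAt.eventually_lt (by fun_prop) (by fun_prop) ?_
    simp only [vec_zero_apply, vec_one_apply, vec_two_apply]
    nlinarith [pow_pos hxy 2]
  filter_upwards [e1, e2, e3] with v h1 h2 h3
  rw [← vec_eta v, ← hg.frame.vec_div h1]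
  generalize v 0 = a at *
  generalize v 1 = b at *
  generalize v 2 = z at *
  -- The target is the source times `(1 + i t) (1 + i t')`, with `t`, `t'` the roots of a quadratic.
  obtain ⟨X, hX⟩ : ∃ X, X = a / z := ⟨_, rfl⟩
  obtain ⟨Y, hY⟩ : ∃ Y, Y = b / z := ⟨_, rfl⟩
  have ha : a = z * X := by rw [hX]; field_simp
  have hb : b = z * Y := by rw [hY]; field_simp
  rw [← hX, ← hY]
  have hz : 0 < z ^ 2 := by positivity
  have hr : 0 < X ^ 2 + Y ^ 2 := by
    refine pos_of_mul_pos_right (a := z ^ 2) ?_ hz.le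
    rw [ha, hb] at h2
    linarith
  obtain ⟨u, hu⟩ : ∃ u, u = (x * X + y * Y) / (X ^ 2 + Y ^ 2) := ⟨_, rfl⟩
  obtain ⟨s, hs⟩ : ∃ s, s = (y * X - x * Y) / (X ^ 2 + Y ^ 2) := ⟨_, rfl⟩
  rw [eq_div_iff hr.ne'] at hu hs
  have hdisc : 0 ≤ s ^ 2 - 4 * (1 - u) := by
    have h4 : 0 < (z ^ 2) ^ 2 * (X ^ 2 + Y ^ 2) ^ 2 * (s ^ 2 - 4 * (1 - u)) := by
      have e1 : (z * (y * a - x * b)) = z ^ 2 * (s * (X ^ 2 + Y ^ 2)) := by rw [hs, ha, hb]; ring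
      have e2 : (z * (x * a + y * b)) = z ^ 2 * (u * (X ^ 2 + Y ^ 2)) := by rw [hu, ha, hb]; ring
      have e3 : a ^ 2 + b ^ 2 = z ^ 2 * (X ^ 2 + Y ^ 2) := by rw [ha, hb]; ring
      rw [e1, e2, e3] at h3
      linarith
    exact (pos_of_mul_pos_right h4 (by positivity)).le
  obtain ⟨d, hd⟩ : ∃ d, d ^ 2 = s ^ 2 - 4 * (1 - u) := ⟨_, Real.sq_sqrt hdisc⟩
  have g1 := hg.le_descent h0 hr ((s + d) / 2)
  have g2 := hg.le_descent h0 (x := X - (s + d) / 2 * Y) (y := Y + (s + d) / 2 * X) (by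
    have : (X - (s + d) / 2 * Y) ^ 2 + (Y + (s + d) / 2 * X) ^ 2 =
        (1 + ((s + d) / 2) ^ 2) * (X ^ 2 + Y ^ 2) := by ring
    rw [this]; positivity) ((s - d) / 2)
  have hx : X - (s + d) / 2 * Y - (s - d) / 2 * (Y + (s + d) / 2 * X) = x := by
    have : (X - (s + d) / 2 * Y - (s - d) / 2 * (Y + (s + d) / 2 * X) - x) *
        (X ^ 2 + Y ^ 2) = 0 := by
      linear_combination (X * (X ^ 2 + Y ^ 2) / 4) * hd + X * hu - Y * hs
    linarith [(mul_eq_zero.1 this).resolve_right hr.ne']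
  have hy : Y + (s + d) / 2 * X + (s - d) / 2 * (X - (s + d) / 2 * Y) = y := by
    have : (Y + (s + d) / 2 * X + (s - d) / 2 * (X - (s + d) / 2 * Y) - y) *
        (X ^ 2 + Y ^ 2) = 0 := by
      linear_combination (Y * (X ^ 2 + Y ^ 2) / 4) * hd + Y * hu + X * hs
    linarith [(mul_eq_zero.1 this).resolve_right hr.ne']
  rw [hx, hy] at g2
  linarith

end IsPolarFrame

lemma norm_inv_norm_smul {x : EuclideanSpace ℝ (Fin 3)} (hx : x ≠ 0) : ‖(‖x‖)⁻¹ • x‖ = 1 := by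
  rw [norm_smul, norm_inv, norm_norm, inv_mul_cancel₀ (norm_ne_zero_iff.2 hx)]

lemma exists_isometry {r p : EuclideanSpace ℝ (Fin 3)} (hr : ‖r‖ = 1) (hp : ‖p‖ = 1)
    (h : inner ℝ r p = 0) :
    ∃ A : EuclideanSpace ℝ (Fin 3) ≃ₗᵢ[ℝ] EuclideanSpace ℝ (Fin 3),
      A (vec 1 0 0) = r ∧ A (vec 0 0 1) = p := by
  have ho : Orthonormal ℝ (({0, 2} : Set (Fin 3)).domRestrict ![r, 0, p]) := by
    constructor
    · rintro ⟨i, hi⟩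
      fin_cases i <;> simp at hi ⊢ <;> assumption
    · rintro ⟨i, hi⟩ ⟨j, hj⟩ hij
      fin_cases i <;> fin_cases j <;> simp_all [real_inner_comm]
  obtain ⟨b, hb⟩ := ho.exists_orthonormalBasis_extension_of_card_eq (by simp)
  refine ⟨b.repr.symm, ?_, ?_⟩
  · have h0 := hb 0 (by simp)
    have : vec 1 0 0 = EuclideanSpace.single 0 1 := by ext i; fin_cases i <;> simp [vec]
    rw [this, OrthonormalBasis.repr_symm_single, h0]; rfl
  · have h0 := hb 2 (by simp)
    have : vec 0 0 1 = EuclideanSpace.single 2 1 := by ext i; fin_cases i <;> simp [vec]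
    rw [this, OrthonormalBasis.repr_symm_single, h0]; rfl

lemma exists_orthogonal (x y : EuclideanSpace ℝ (Fin 3)) :
    ∃ n, ‖n‖ = 1 ∧ inner ℝ x n = 0 ∧ inner ℝ y n = 0 := by
  have hlt : Module.finrank ℝ (Submodule.span ℝ ({x, y} : Set (EuclideanSpace ℝ (Fin 3)))) < 3 := by
    classical
    have := finrank_span_finset_le_card (R := ℝ) ({x, y} : Finset (EuclideanSpace ℝ (Fin 3)))
    have h2 := Finset.card_le_two (a := x) (b := y)
    simp only [Finset.coe_insert, Finset.coe_singleton] at this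
    change Module.finrank ℝ (Submodule.span ℝ ({x, y} : Set (EuclideanSpace ℝ (Fin 3)))) ≤ _ at this
    omega
  have hne : (Submodule.span ℝ ({x, y} : Set (EuclideanSpace ℝ (Fin 3))))ᗮ ≠ ⊥ := by
    intro h
    rw [Submodule.orthogonal_eq_bot_iff] at h
    rw [h, finrank_top] at hlt
    simp at hlt
  obtain ⟨n, hn, hn0⟩ := Submodule.exists_mem_ne_zero_of_ne_bot hne
  rw [Submodule.mem_orthogonal] at hn
  refine ⟨(‖n‖)⁻¹ • n, norm_inv_norm_smul hn0, ?_, ?_⟩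
  · rw [inner_smul_right, hn x (Submodule.subset_span (by simp)), mul_zero]
  · rw [inner_smul_right, hn y (Submodule.subset_span (by simp)), mul_zero]

lemma exists_isometry_pole {p : EuclideanSpace ℝ (Fin 3)} (hp : ‖p‖ = 1) :
    ∃ A : EuclideanSpace ℝ (Fin 3) ≃ₗᵢ[ℝ] EuclideanSpace ℝ (Fin 3), A (vec 0 0 1) = p := by
  obtain ⟨n, hn, h, -⟩ := exists_orthogonal p p
  obtain ⟨A, -, hA⟩ := exists_isometry hn hp (by rwa [real_inner_comm])
  exact ⟨A, hA⟩

namespace IsFrame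

variable {f : EuclideanSpace ℝ (Fin 3) → ℝ} {w : ℝ}

lemma normalize (hf : IsFrame f w) {x : EuclideanSpace ℝ (Fin 3)} (hx : x ≠ 0) :
    f ((‖x‖)⁻¹ • x) = f x :=
  hf.smul _ _ (inv_ne_zero (norm_ne_zero_iff.2 hx))

lemma eventually_le (hf : IsFrame f w) (h0 : ∀ v ≠ 0, 0 ≤ f v) {ε : ℝ} (hε : 0 < ε)
    {p : EuclideanSpace ℝ (Fin 3)} (hp : p ≠ 0) (hle : f p ≤ ε) :
    ∃ v₀ ≠ 0, ∀ᶠ v in nhds v₀, f v ≤ 7 * ε := by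
  obtain ⟨A, hA⟩ := exists_isometry_pole (norm_inv_norm_smul hp)
  have hfA := hf.comp A.toLinearIsometry
  have h0A : ∀ v ≠ 0, 0 ≤ f (A v) := fun v hv =>
    h0 _ ((map_ne_zero_iff A A.injective).2 hv)
  obtain ⟨v₀, hv₀, h⟩ := hfA.isPolarFrame.eventually_le
    (fun v hv => add_nonneg (h0A v hv)
      (h0A _ ((map_ne_zero_iff quarterTurn quarterTurn.injective).2 hv))) hε
  refine ⟨A v₀, (map_ne_zero_iff A A.injective).2 hv₀, ?_⟩
  have hc : Filter.Tendsto A.symm (nhds (A v₀)) (nhds v₀) := by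
    have := A.symm.continuous.tendsto (A v₀)
    rwa [A.symm_apply_apply] at this
  have hne : ∀ᶠ v in nhds (A v₀), v ≠ 0 :=
    eventually_ne_nhds ((map_ne_zero_iff A A.injective).2 hv₀)
  filter_upwards [hc.eventually h, hne] with v hv hv0
  simp only [LinearIsometryEquiv.coe_toLinearIsometry, A.apply_symm_apply, hA] at hv
  have h1 := h0A (quarterTurn (A.symm v)) ((map_ne_zero_iff quarterTurn quarterTurn.injective).2
    ((map_ne_zero_iff A.symm A.symm.injective).2 hv0))
  rw [hf.normalize hp] at hv
  linarith

/-- On a plane, a frame function takes the same sum on all orthogonal pairs. -/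
lemma sum_plane (hf : IsFrame f w) {x y : EuclideanSpace ℝ (Fin 3)} (hx : x ≠ 0) (hy : y ≠ 0)
    {a b a' b' : ℝ} (hx' : a • x + b • y ≠ 0) (hy' : a' • x + b' • y ≠ 0)
    (h : inner ℝ x (a • x + b • y) = 0) (h' : inner ℝ y (a' • x + b' • y) = 0) :
    f x + f (a • x + b • y) = f y + f (a' • x + b' • y) := by
  obtain ⟨n, hn, h1, h2⟩ := exists_orthogonal x y
  have hn0 : n ≠ 0 := by rintro rfl; simp at hn
  have e1 := hf.sum x _ n hx hx' hn0 h h1 (by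
    simp [inner_add_left, inner_smul_left, h1, h2])
  have e2 := hf.sum y _ n hy hy' hn0 h' h2 (by
    simp [inner_add_left, inner_smul_left, h1, h2])
  linarith

lemma spread (hf : IsFrame f w) {r q : EuclideanSpace ℝ (Fin 3)} (hr : r ≠ 0) (hq : q ≠ 0)
    (hrq : inner ℝ q r = 0) {m δ : ℝ} (h : ∀ᶠ v in nhds r, |f v - m| ≤ δ) :
    ∃ m', ∀ᶠ v in nhds q, |f v - m'| ≤ 2 * δ := by
  have hU := h.and (eventually_ne_nhds hr)
  set κ : ℝ := ‖r‖ ^ 2 / ‖q‖ ^ 2 with hκ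
  have hq2 : ‖q‖ ^ 2 ≠ 0 := by simpa using hq
  have hr2 : 0 < ‖r‖ ^ 2 := by positivity
  have ht : Filter.Tendsto (fun η : ℝ => r - (η * κ) • q) (nhdsWithin 0 (Set.Ioi 0)) (nhds r) := by
    have : ContinuousAt (fun η : ℝ => r - (η * κ) • q) 0 := by fun_prop
    have := this.tendsto
    simp only [zero_mul, zero_smul, sub_zero] at this
    exact this.mono_left nhdsWithin_le_nhds
  obtain ⟨η, hη1, hη⟩ := ((ht.eventually hU.eventually_nhds).and self_mem_nhdsWithin).exists
  replace hη : 0 < η := hη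
  set q₃ := q + η • r with hq₃
  have hq₃q : inner ℝ q₃ q = ‖q‖ ^ 2 := by
    rw [hq₃, inner_add_left, inner_smul_left, real_inner_self_eq_norm_sq, real_inner_comm, hrq]
    simp
  have hq₃q₃ : inner ℝ q₃ q₃ = ‖q‖ ^ 2 + η ^ 2 * ‖r‖ ^ 2 := by
    conv_lhs => rw [hq₃]
    simp only [inner_add_left, inner_add_right, inner_smul_left, inner_smul_right,
      real_inner_self_eq_norm_sq, hrq, real_inner_comm q r]
    simp
    ring
  have hq₃0 : q₃ ≠ 0 := by
    intro h0
    rw [h0, inner_zero_left] at hq₃q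
    exact hq2 hq₃q.symm
  -- the vector of the plane of `v` and `q₃` that is orthogonal to `v`
  let F : EuclideanSpace ℝ (Fin 3) → EuclideanSpace ℝ (Fin 3) := fun v =>
    (-(η⁻¹ * inner ℝ v q₃ / inner ℝ v v)) • v + η⁻¹ • q₃
  -- the vector of the plane of `v` and `q₃` that is orthogonal to `q₃`
  let G : EuclideanSpace ℝ (Fin 3) → EuclideanSpace ℝ (Fin 3) := fun v =>
    (-(η⁻¹ * inner ℝ q₃ q₃ / ‖q‖ ^ 2)) • v + (η⁻¹ * inner ℝ q₃ v / ‖q‖ ^ 2) • q₃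
  have hF : ContinuousAt F q := by
    have : inner ℝ q q ≠ 0 := by rw [real_inner_self_eq_norm_sq]; exact hq2
    have h1 : ContinuousAt (fun v => -(η⁻¹ * inner ℝ v q₃ / inner ℝ v v)) q := by
      have hn : ContinuousAt (fun v => η⁻¹ * inner ℝ v q₃) q := by fun_prop
      have hd : ContinuousAt (fun v : EuclideanSpace ℝ (Fin 3) => inner ℝ v v) q := by fun_prop
      exact (hn.div hd this).neg
    exact (h1.smul continuousAt_id).add continuousAt_const
  have hG : ContinuousAt G q := by
    have h1 : ContinuousAt (fun v => (η⁻¹ * inner ℝ q₃ v / ‖q‖ ^ 2)) q := by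
      fun_prop
    have h2 : ContinuousAt (fun v => (-(η⁻¹ * inner ℝ q₃ q₃ / ‖q‖ ^ 2)) • v) q := by fun_prop
    exact h2.add (h1.smul continuousAt_const)
  have hFq : F q = r := by
    simp only [F, real_inner_comm q₃ q, hq₃q, real_inner_self_eq_norm_sq]
    rw [mul_div_assoc, div_self hq2, hq₃, smul_add, smul_smul, inv_mul_cancel₀ hη.ne']
    simp
  have hGq : G q = r - (η * κ) • q := by
    simp only [G, hq₃q, hq₃q₃]
    rw [hq₃, hκ]
    match_scalars <;> field_simp <;> ring
  rw [← hGq] at hη1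
  have e1 : ∀ᶠ v in nhds q, |f (F v) - m| ≤ δ ∧ F v ≠ 0 := by
    have := hF.tendsto
    rw [hFq] at this
    exact this.eventually hU
  have e2 : ∀ᶠ v in nhds q, |f (G v) - m| ≤ δ ∧ G v ≠ 0 := hG.tendsto.eventually hη1
  refine ⟨f q₃, ?_⟩
  filter_upwards [e1, e2, eventually_ne_nhds hq] with v h1 h2 hv
  have key := hf.sum_plane hv hq₃0 h1.2 h2.2 (by
    have : inner ℝ v v ≠ 0 := inner_self_ne_zero.2 hv
    rw [inner_add_right, inner_smul_right, inner_smul_right]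
    field_simp
    ring) (by
    rw [inner_add_right, inner_smul_right, inner_smul_right]
    field_simp
    ring)
  have e : f v - f q₃ = (f (G v) - m) - (f (F v) - m) := by
    simp only [F, G]; linarith
  rw [e]
  refine (abs_sub _ _).trans ?_
  linarith [h1.1, h2.1]

/-- A frame function that is bounded below is continuous. -/
theorem continuousAt (hf : IsFrame f w) {b : ℝ} (hb : ∀ v ≠ 0, b ≤ f v)
    {q : EuclideanSpace ℝ (Fin 3)} (hq : q ≠ 0) : ContinuousAt f q := by
  set S : Set ℝ := f '' {0}ᶜ with hS
  have hne : S.Nonempty := ⟨f q, q, hq, rfl⟩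
  have hbd : BddBelow S := ⟨b, by rintro _ ⟨v, hv, rfl⟩; exact hb v hv⟩
  set m := sInf S
  have hm : ∀ v ≠ 0, m ≤ f v := fun v hv => csInf_le hbd ⟨v, hv, rfl⟩
  have hf' := hf.add (IsFrame.const (-m))
  rw [Metric.continuousAt_iff']
  intro ε hε
  have hε' : 0 < ε / 57 := by positivity
  obtain ⟨_, ⟨p, hp, rfl⟩, hlt⟩ := exists_lt_of_csInf_lt hne (lt_add_of_pos_right m hε')
  obtain ⟨v₀, hv₀, h⟩ := hf'.eventually_le (fun v hv => by linarith [hm v hv]) hε' hp (by linarith)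
  have h1 : ∀ᶠ v in nhds v₀, |f v - m| ≤ 7 * (ε / 57) := by
    filter_upwards [h, eventually_ne_nhds hv₀] with v hv hv0
    rw [abs_of_nonneg (by linarith [hm v hv0])]
    linarith
  obtain ⟨n, hn, hn1, hn2⟩ := exists_orthogonal v₀ q
  have hn0 : n ≠ 0 := by rintro rfl; simp at hn
  obtain ⟨m₁, h2⟩ := hf.spread hv₀ hn0 (by rwa [real_inner_comm]) h1
  obtain ⟨m₂, h3⟩ := hf.spread hn0 hq hn2 h2
  filter_upwards [h3] with v hv
  have h4 := h3.self_of_nhds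
  rw [Real.dist_eq]
  rw [abs_le] at hv h4
  rw [abs_lt]
  constructor <;> linarith [hv.1, hv.2, h4.1, h4.2]

end IsFrame

namespace IsPolarFrame

variable {g : EuclideanSpace ℝ (Fin 3) → ℝ} {T c : ℝ}

lemma le_of_le_north (hg : IsPolarFrame g T c) (hT : ∀ v ≠ 0, g v ≤ T)
    {v : EuclideanSpace ℝ (Fin 3)} (hv : v ≠ 0) : c ≤ g v := by
  have hc : c ≤ T := by
    rw [← hg.equator 1 0 (by norm_num)]
    exact hT _ ((vec_ne_zero_iff _ _ _).2 (by norm_num))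
  rw [← vec_eta v] at hv ⊢
  generalize v 0 = a at *
  generalize v 1 = b at *
  generalize v 2 = z at *
  rw [vec_ne_zero_iff] at hv
  by_cases h : 0 < a ^ 2 + b ^ 2
  · have h1 := hg.partner h z
    have h2 := hT (vec (a * z) (b * z) (-(a ^ 2 + b ^ 2))) ((vec_ne_zero_iff _ _ _).2
      (by nlinarith [pow_pos h 2, sq_nonneg (a * z), sq_nonneg (b * z)]))
    linarith
  · have ha : a = 0 := by nlinarith
    have hb : b = 0 := by nlinarith
    subst ha hb
    rwa [hg.frame.pole (by rintro rfl; norm_num at hv), hg.north]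

lemma descent_le (hg : IsPolarFrame g T c) (hT : ∀ v ≠ 0, g v ≤ T) {z : ℂ} (hz : z ≠ 0) (t : ℝ) :
    g (vec (z * (1 + t * Complex.I)).re (z * (1 + t * Complex.I)).im 1) ≤ g (vec z.re z.im 1) := by
  have h : 0 < z.re ^ 2 + z.im ^ 2 := by
    have := Complex.normSq_pos.2 hz
    rw [Complex.normSq_apply] at this
    linarith
  obtain ⟨v, hv, h1⟩ := hg.descent h t
  have h2 := hg.le_of_le_north hT hv
  have e1 : (z * (1 + t * Complex.I)).re = z.re - t * z.im := by simp; ring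
  have e2 : (z * (1 + t * Complex.I)).im = z.im + t * z.re := by simp; ring
  rw [e1, e2]
  linarith

lemma descent_pow_le (hg : IsPolarFrame g T c) (hT : ∀ v ≠ 0, g v ≤ T) {z : ℂ} (hz : z ≠ 0)
    (t : ℝ) (n : ℕ) :
    g (vec (z * (1 + t * Complex.I) ^ n).re (z * (1 + t * Complex.I) ^ n).im 1) ≤
      g (vec z.re z.im 1) := by
  induction n with
  | zero => simp
  | succ n ih =>
    have h0 : (1 + t * Complex.I : ℂ) ≠ 0 := by
      intro h
      simpa using congrArg Complex.re h
    refine le_trans ?_ ih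
    rw [pow_succ, ← mul_assoc]
    exact hg.descent_le hT (mul_ne_zero hz (pow_ne_zero n h0)) t

lemma rotate_le (hg : IsPolarFrame g T c) (hT : ∀ v ≠ 0, g v ≤ T)
    (hcont : ∀ v ≠ 0, ContinuousAt g v) {z : ℂ} (hz : z ≠ 0) (φ : ℝ) :
    g (vec (z * Complex.exp (φ * Complex.I)).re (z * Complex.exp (φ * Complex.I)).im 1) ≤
      g (vec z.re z.im 1) := by
  have h1 := (Complex.tendsto_one_add_div_pow_exp (φ * Complex.I)).const_mul z
  have h2 : Continuous fun ζ : ℂ => vec ζ.re ζ.im 1 :=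
    continuous_vec Complex.continuous_re Complex.continuous_im continuous_const
  have h3 := (hcont
    (vec (z * Complex.exp (φ * Complex.I)).re (z * Complex.exp (φ * Complex.I)).im 1)
    ((vec_ne_zero_iff _ _ _).2 (by positivity))).tendsto.comp ((h2.tendsto _).comp h1)
  refine le_of_tendsto h3 (Filter.Eventually.of_forall fun n => ?_)
  have := hg.descent_pow_le hT hz (φ / n) n
  have e : ((φ / n : ℝ) : ℂ) * Complex.I = φ * Complex.I / n := by
    push_cast
    ring
  rw [e] at this
  exact this

lemma eq_norm (hg : IsPolarFrame g T c) (hT : ∀ v ≠ 0, g v ≤ T)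
    (hcont : ∀ v ≠ 0, ContinuousAt g v) {z : ℂ} (hz : z ≠ 0) :
    g (vec z.re z.im 1) = g (vec ‖z‖ 0 1) := by
  have h1 : (‖z‖ : ℂ) * Complex.exp (z.arg * Complex.I) = z := Complex.norm_mul_exp_arg_mul_I z
  have h2 : z * Complex.exp ((-z.arg : ℝ) * Complex.I) = ‖z‖ := by
    conv_lhs => rw [← h1]
    rw [mul_assoc, ← Complex.exp_add]
    simp
  apply le_antisymm
  · have := hg.rotate_le hT hcont (z := ‖z‖) (by simpa using hz) z.arg
    rw [h1] at this
    simpa using this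
  · have := hg.rotate_le hT hcont hz (-z.arg)
    rw [h2] at this
    simpa using this

lemma eq_latitude (hg : IsPolarFrame g T c) (hT : ∀ v ≠ 0, g v ≤ T)
    (hcont : ∀ v ≠ 0, ContinuousAt g v) {a b z : ℝ} (h : a ^ 2 + b ^ 2 + z ^ 2 = 1) :
    g (vec a b z) = g (vec √(1 - z ^ 2) 0 √(z ^ 2)) := by
  have hab : 1 - z ^ 2 = a ^ 2 + b ^ 2 := by linarith
  by_cases hz : z = 0
  · subst hz
    rw [hg.equator a b (by nlinarith)]
    simpa using (hg.equator 1 0 (by norm_num)).symm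
  by_cases h0 : 0 < a ^ 2 + b ^ 2
  · have hs : √(z ^ 2) ≠ 0 := (Real.sqrt_pos.2 (by positivity)).ne'
    have h1 := hg.eq_norm hT hcont (z := ⟨a / z, b / z⟩) (by
      intro hh
      have e1 := congrArg Complex.re hh
      have e2 := congrArg Complex.im hh
      simp [hz] at e1 e2
      simp [e1, e2] at h0)
    have h2 : ‖(⟨a / z, b / z⟩ : ℂ)‖ = √(1 - z ^ 2) / √(z ^ 2) := by
      rw [Complex.norm_eq_sqrt_sq_add_sq, ← Real.sqrt_div (by rw [hab]; positivity), hab]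
      congr 1
      field_simp
    rw [h2, hg.frame.vec_div hz] at h1
    rw [h1, ← hg.frame.vec_div hs, zero_div]
  · have ha : a = 0 := by nlinarith
    have hb : b = 0 := by nlinarith
    subst ha hb
    have : z ^ 2 = 1 := by linarith
    rw [hg.frame.pole hz, this]
    simp

/-- A continuous polar frame function that is maximal at the pole is an affine function of the
squared height. -/
theorem eq_affine (hg : IsPolarFrame g T c) (hT : ∀ v ≠ 0, g v ≤ T)
    (hcont : ∀ v ≠ 0, ContinuousAt g v) {a b z : ℝ} (h : a ^ 2 + b ^ 2 + z ^ 2 = 1) :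
    g (vec a b z) = T * z ^ 2 + c * (1 - z ^ 2) := by
  set D : ℝ → ℝ := fun u => g (vec √(1 - u) 0 √u) - (T * u + c * (1 - u)) with hD
  have hlat : ∀ {a b z : ℝ}, a ^ 2 + b ^ 2 + z ^ 2 = 1 →
      g (vec a b z) = D (z ^ 2) + (T * z ^ 2 + c * (1 - z ^ 2)) := by
    intro a b z h
    rw [hg.eq_latitude hT hcont h, hD]
    ring
  have hcT : c ≤ T := by
    rw [← hg.equator 1 0 (by norm_num)]
    exact hT _ ((vec_ne_zero_iff _ _ _).2 (by norm_num))
  have hbound : ∀ u, 0 ≤ u → u ≤ 1 → |D u| ≤ T - c := by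
    intro u hu hu'
    have hne : vec √(1 - u) 0 √u ≠ 0 := by
      rw [vec_ne_zero_iff, Real.sq_sqrt (by linarith), Real.sq_sqrt hu]
      linarith
    have h1 := hT _ hne
    have h2 := hg.le_of_le_north hT hne
    simp only [hD]
    rw [abs_le]
    constructor <;> nlinarith
  have hcompl : ∀ u, 0 ≤ u → u ≤ 1 → D (1 - u) = -D u := by
    intro u hu hu'
    obtain ⟨s, hs⟩ : ∃ s, s ^ 2 = u := ⟨_, Real.sq_sqrt hu⟩
    obtain ⟨p, hp⟩ : ∃ p, p ^ 2 = 1 - u := ⟨_, Real.sq_sqrt (by linarith)⟩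
    have h1 := hg.frame.sum_vec (a := p) (b := 0) (c := s) (a' := s) (b' := 0) (c' := -p)
      (a'' := 0) (b'' := 1) (c'' := 0) (by linarith) (by linarith) (by norm_num) (by ring)
      (by ring) (by ring)
    rw [hg.equator 0 1 (by norm_num), hlat (by linarith), hlat (by linarith), neg_sq, hs, hp] at h1
    linarith
  have hdouble : ∀ u, 0 ≤ u → u ≤ 1 / 2 → D (1 - 2 * u) = -(2 * D u) := by
    intro u hu hu'
    obtain ⟨s, hs⟩ : ∃ s, s ^ 2 = u := ⟨_, Real.sq_sqrt hu⟩
    obtain ⟨p, hp⟩ : ∃ p, p ^ 2 = 1 - 2 * u := ⟨_, Real.sq_sqrt (by linarith)⟩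
    obtain ⟨k, hk⟩ : ∃ k : ℝ, k ^ 2 = 1 / 2 := ⟨_, Real.sq_sqrt (by norm_num)⟩
    have n1 : (2 * k * s) ^ 2 + 0 ^ 2 + p ^ 2 = 1 := by
      linear_combination 4 * s ^ 2 * hk + 2 * hs + hp
    have n2 : (-(k * p)) ^ 2 + k ^ 2 + s ^ 2 = 1 := by
      linear_combination (p ^ 2 + 1) * hk + hs + hp / 2
    have n3 : (-(k * p)) ^ 2 + (-k) ^ 2 + s ^ 2 = 1 := by linarith
    have h1 := hg.frame.sum_vec (a := 2 * k * s) (b := 0) (c := p) (a' := -(k * p)) (b' := k)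
      (c' := s) (a'' := -(k * p)) (b'' := -k) (c'' := s) (by linarith) (by linarith)
      (by linarith) (by linear_combination (-2 * s * p) * hk)
      (by linear_combination (-2 * s * p) * hk)
      (by linear_combination (p ^ 2 - 1) * hk + hs + hp / 2)
    rw [hlat n1, hlat n2, hlat n3, hs, hp] at h1
    linarith
  have hsmall : ∀ (n : ℕ) u, 0 ≤ u → u ≤ 1 → |D u| ≤ (T - c) / 2 ^ n := by
    intro n
    induction n with
    | zero => simpa using hbound
    | succ n ih =>
      have hhalf : ∀ u, 0 ≤ u → u ≤ 1 / 2 → |D u| ≤ (T - c) / 2 ^ (n + 1) := by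
        intro u hu hu'
        have h1 := ih (1 - 2 * u) (by linarith) (by linarith)
        rw [hdouble u hu hu', abs_neg, abs_mul, abs_two] at h1
        rw [pow_succ, ← div_div]
        linarith
      intro u hu hu'
      rcases le_total u (1 / 2) with h1 | h1
      · exact hhalf u hu h1
      · have := hhalf (1 - u) (by linarith) (by linarith)
        rwa [hcompl u hu hu', abs_neg] at this
  have hz : z ^ 2 ≤ 1 := by nlinarith
  have hzero : D (z ^ 2) = 0 := by
    have ht : Filter.Tendsto (fun n : ℕ => (T - c) / 2 ^ n) Filter.atTop (nhds 0) :=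
      tendsto_const_nhds.div_atTop (tendsto_pow_atTop_atTop_of_one_lt one_lt_two)
    have := ge_of_tendsto ht (Filter.Eventually.of_forall fun n => hsmall n _ (sq_nonneg z) hz)
    exact abs_nonpos_iff.1 this
  rw [hlat h, hzero, zero_add]

end IsPolarFrame

/-- The cyclic permutation of the coordinates. -/
noncomputable def cycle : EuclideanSpace ℝ (Fin 3) →ₗᵢ[ℝ] EuclideanSpace ℝ (Fin 3) where
  toFun x := vec (x 2) (x 0) (x 1)
  map_add' x y := by ext i; fin_cases i <;> simp [vec]
  map_smul' t x := by ext i; fin_cases i <;> simp [vec]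
  norm_map' x := by
    rw [← sq_eq_sq₀ (norm_nonneg _) (norm_nonneg _)]
    conv_rhs => rw [← vec_eta x, norm_sq_vec]
    exact (norm_sq_vec _ _ _).trans (by ring)

lemma cycle_vec (a b c : ℝ) : cycle (vec a b c) = vec c a b := rfl

lemma exists_normalizedBasis {x y z : EuclideanSpace ℝ (Fin 3)} (hx : x ≠ 0) (hy : y ≠ 0)
    (hz : z ≠ 0) (hxy : inner ℝ x y = 0) (hxz : inner ℝ x z = 0) (hyz : inner ℝ y z = 0) :
    ∃ e : OrthonormalBasis (Fin 3) ℝ (EuclideanSpace ℝ (Fin 3)),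
      e 0 = (‖x‖)⁻¹ • x ∧ e 1 = (‖y‖)⁻¹ • y ∧ e 2 = (‖z‖)⁻¹ • z := by
  have ho : Orthonormal ℝ (Set.univ.domRestrict ![(‖x‖)⁻¹ • x, (‖y‖)⁻¹ • y, (‖z‖)⁻¹ • z]) := by
    have hunit : ∀ v : EuclideanSpace ℝ (Fin 3), v ≠ 0 → (‖v‖)⁻¹ * ‖v‖ = 1 := fun v hv =>
      inv_mul_cancel₀ (norm_ne_zero_iff.2 hv)
    have hyx : inner ℝ y x = 0 := by rwa [real_inner_comm]
    have hzx : inner ℝ z x = 0 := by rwa [real_inner_comm]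
    have hzy : inner ℝ z y = 0 := by rwa [real_inner_comm]
    constructor
    · rintro ⟨i, -⟩
      fin_cases i <;> simpa [norm_smul] using hunit _ ‹_›
    · rintro ⟨i, -⟩ ⟨j, -⟩
      fin_cases i <;> fin_cases j <;>
        simp [inner_smul_left, inner_smul_right, hxy, hxz, hyz, hyx, hzx, hzy]
  obtain ⟨e, he⟩ := ho.exists_orthonormalBasis_extension_of_card_eq (by simp)
  exact ⟨e, he 0 trivial, he 1 trivial, he 2 trivial⟩

namespace IsFrame

variable {f h : EuclideanSpace ℝ (Fin 3) → ℝ} {w : ℝ}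

lemma add_quarterTurn (hf : IsFrame f w) (hcont : ∀ v ≠ 0, ContinuousAt f v)
    (hmax : ∀ v ≠ 0, f v ≤ f (vec 0 0 1)) {a b z : ℝ} (h : a ^ 2 + b ^ 2 + z ^ 2 = 1) :
    f (vec a b z) + f (vec (-b) a z) =
      2 * f (vec 0 0 1) * z ^ 2 + (w - f (vec 0 0 1)) * (1 - z ^ 2) := by
  have hQ : ∀ v ≠ 0, quarterTurn v ≠ 0 := fun v hv =>
    (map_ne_zero_iff quarterTurn quarterTurn.injective).2 hv
  refine hf.isPolarFrame.eq_affine (fun v hv => ?_) (fun v hv => ?_) h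
  · linarith [hmax v hv, hmax _ (hQ v hv)]
  · exact (hcont v hv).add
      (ContinuousAt.comp (hcont _ (hQ v hv)) quarterTurn.continuous.continuousAt)

/-- At a maximal point `p`, the sum of the values at two points of the same latitude with respect
to `p` and orthogonal longitudes is known. -/
lemma exists_partner (hf : IsFrame f w) (hcont : ∀ v ≠ 0, ContinuousAt f v)
    {p : EuclideanSpace ℝ (Fin 3)} (hp : ‖p‖ = 1) (hmax : ∀ v ≠ 0, f v ≤ f p)
    {s : EuclideanSpace ℝ (Fin 3)} (hs : ‖s‖ = 1) :
    ∃ s' ≠ 0, f s + f s' = 2 * f p * inner ℝ p s ^ 2 + (w - f p) * (1 - inner ℝ p s ^ 2) := by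
  obtain ⟨A, rfl⟩ := exists_isometry_pole hp
  obtain ⟨s, rfl⟩ := A.surjective s
  have hA : ∀ v ≠ 0, A v ≠ 0 := fun v hv => (map_ne_zero_iff A A.injective).2 hv
  have h1 := (hf.comp A.toLinearIsometry).add_quarterTurn
    (fun v hv => ContinuousAt.comp (hcont _ (hA v hv)) A.continuous.continuousAt)
    (fun v hv => hmax _ (hA v hv)) (a := s 0) (b := s 1) (z := s 2) (by
      rw [← norm_sq_vec, vec_eta, ← A.norm_map s, hs, one_pow])
  have h2 : inner ℝ (A (vec 0 0 1)) (A s) = s 2 := by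
    rw [A.inner_map_map]
    conv_lhs => rw [← vec_eta s, inner_vec]
    ring
  rw [h2]
  refine ⟨A (vec (-s 1) (s 0) (s 2)), hA _ ?_, ?_⟩
  · rw [vec_ne_zero_iff]
    have : s 0 ^ 2 + s 1 ^ 2 + s 2 ^ 2 = 1 := by
      rw [← norm_sq_vec, vec_eta, ← A.norm_map s, hs, one_pow]
    linarith
  · simp only [LinearIsometryEquiv.coe_toLinearIsometry] at h1
    rwa [vec_eta] at h1

lemma exists_max (hf : IsFrame f w) (hcont : ∀ v ≠ 0, ContinuousAt f v)
    {K : Submodule ℝ (EuclideanSpace ℝ (Fin 3))} (hK : K ≠ ⊥) :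
    ∃ p ∈ K, ‖p‖ = 1 ∧ ∀ v ∈ K, v ≠ 0 → f v ≤ f p := by
  have hcomp : IsCompact ((K : Set (EuclideanSpace ℝ (Fin 3))) ∩ Metric.sphere 0 1) :=
    (isCompact_sphere _ _).inter_left K.closed_of_finiteDimensional
  obtain ⟨v, hv, hv0⟩ := K.ne_bot_iff.1 hK
  obtain ⟨p, hp, hmax⟩ := hcomp.exists_isMaxOn
    ⟨(‖v‖)⁻¹ • v, K.smul_mem _ hv, by simpa using norm_inv_norm_smul hv0⟩
    (f := f) (fun x hx => (hcont x (by rintro rfl; simp at hx)).continuousWithinAt)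
  refine ⟨p, hp.1, by simpa using hp.2, fun x hx hx0 => ?_⟩
  rw [← hf.normalize hx0]
  exact hmax ⟨K.smul_mem _ hx, by simpa using norm_inv_norm_smul hx0⟩

/-- A continuous frame function of weight zero that changes sign under the quarter turns about the
coordinate axes vanishes. -/
lemma eq_zero_of_odd (hf : IsFrame h 0) (hcont : ∀ v ≠ 0, ContinuousAt h v)
    (h1 : ∀ a b c, vec a b c ≠ 0 → h (vec a (-c) b) = -h (vec a b c))
    (h3 : ∀ a b c, vec a b c ≠ 0 → h (vec (-b) a c) = -h (vec a b c))
    {v : EuclideanSpace ℝ (Fin 3)} (hv : v ≠ 0) : h v = 0 := by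
  obtain ⟨p, -, hp, hmax⟩ := hf.exists_max hcont (K := ⊤) top_ne_bot
  replace hmax : ∀ v ≠ 0, h v ≤ h p := fun v hv => hmax v trivial hv
  have hmin : ∀ v ≠ 0, -h p ≤ h v := by
    intro v hv
    rw [← vec_eta v] at hv ⊢
    have := hmax (vec (-v 1) (v 0) (v 2)) (by
      rw [vec_ne_zero_iff] at hv ⊢
      linarith)
    rw [h3 _ _ _ hv] at this
    linarith
  suffices hp0 : h p ≤ 0 by
    have a := hmax v hv
    have b := hmin v hv
    linarith
  by_contra! hpos
  have hpart : ∀ s : EuclideanSpace ℝ (Fin 3), ‖s‖ = 1 →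
      h p * (3 * inner ℝ p s ^ 2 - 1) - h s ≤ h p ∧
      -h p ≤ h p * (3 * inner ℝ p s ^ 2 - 1) - h s := by
    intro s hs
    obtain ⟨s', hs', e⟩ := hf.exists_partner hcont hp hmax hs
    have a := hmax s' hs'
    have b := hmin s' hs'
    constructor <;> linarith
  have hneg : ∀ v ≠ 0, h (-v) = h v := by
    intro v hv
    simpa using hf.smul (-1) v (by norm_num)
  obtain ⟨x, y, z, rfl⟩ : ∃ x y z, p = vec x y z := ⟨_, _, _, (vec_eta p).symm⟩
  have hn : x ^ 2 + y ^ 2 + z ^ 2 = 1 := by rw [← norm_sq_vec, hp, one_pow]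
  have hne : ∀ {a b c : ℝ}, a ^ 2 + b ^ 2 + c ^ 2 = 1 → vec a b c ≠ 0 := by
    intro a b c habc
    rw [vec_ne_zero_iff, habc]
    norm_num
  have hunit : ∀ {a b c : ℝ}, a ^ 2 + b ^ 2 + c ^ 2 = 1 → ‖vec a b c‖ = 1 := by
    intro a b c habc
    rw [← norm_sq_vec] at habc
    exact (pow_eq_one_iff_of_nonneg (norm_nonneg _) two_ne_zero).1 habc
  have h2 : ∀ a b c, a ^ 2 + b ^ 2 + c ^ 2 = 1 → h (vec (-c) b a) = -h (vec a b c) := by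
    intro a b c habc
    have e1 := h1 (-c) a (-b) (hne (by linarith))
    have e2 := h3 a c (-b) (hne (by linarith))
    have e3 := h1 a c (-b) (hne (by linarith))
    rw [neg_neg] at e1 e3
    linarith
  have hflip : ∀ a b c, a ^ 2 + b ^ 2 + c ^ 2 = 1 → h (-vec a b c) = h (vec a b c) :=
    fun a b c habc => hneg _ (hne habc)
  have vneg : ∀ a b c, -vec a b c = vec (-a) (-b) (-c) := by
    intro a b c
    simpa using _root_.smul_vec (-1) a b c
  have f3 : h (vec x y (-z)) = h (vec x y z) := by
    have e1 := h3 x y z (hne hn)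
    have e2 := h3 (-y) x z (hne (by linarith))
    have e3 := hflip (-x) (-y) z (by linarith)
    rw [vneg, neg_neg, neg_neg] at e3
    linarith
  have f1 : h (vec (-x) y z) = h (vec x y z) := by
    have e1 := h1 x y z (hne hn)
    have e2 := h1 x (-z) y (hne (by linarith))
    have e3 := hflip x (-y) (-z) (by linarith)
    rw [vneg, neg_neg, neg_neg] at e3
    linarith
  have f2 : h (vec x (-y) z) = h (vec x y z) := by
    have e1 := h2 x y z hn
    have e2 := h2 (-z) y x (by linarith)
    have e3 := hflip (-x) y (-z) (by linarith)
    rw [vneg, neg_neg, neg_neg] at e3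
    linarith
  have key : ∀ t : ℝ, h (vec x y z) * (3 * t ^ 2 - 1) - -h (vec x y z) ≤ h (vec x y z) →
      -h (vec x y z) ≤ h (vec x y z) * (3 * (1 - 2 * t) ^ 2 - 1) - h (vec x y z) → t < 1 / 3 := by
    intro t ht ht'
    have a : t ^ 2 ≤ 1 / 3 := by nlinarith
    have b : 1 / 3 ≤ (1 - 2 * t) ^ 2 := by nlinarith
    nlinarith
  have k1 := key (x ^ 2) (by
    have := (hpart (vec x (-z) y) (hunit (by linarith))).1
    rw [inner_vec, h1 _ _ _ (hne hn)] at this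
    rwa [show x * x + y * -z + z * y = x ^ 2 by ring] at this) (by
    have := (hpart (vec (-x) y z) (hunit (by linarith))).2
    rw [inner_vec, f1] at this
    rwa [show x * -x + y * y + z * z = 1 - 2 * x ^ 2 by linarith] at this)
  have k2 := key (y ^ 2) (by
    have := (hpart (vec (-z) y x) (hunit (by linarith))).1
    rw [inner_vec, h2 _ _ _ hn] at this
    rwa [show x * -z + y * y + z * x = y ^ 2 by ring] at this) (by
    have := (hpart (vec x (-y) z) (hunit (by linarith))).2
    rw [inner_vec, f2] at this
    rwa [show x * x + y * -y + z * z = 1 - 2 * y ^ 2 by linarith] at this)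
  have k3 := key (z ^ 2) (by
    have := (hpart (vec (-y) x z) (hunit (by linarith))).1
    rw [inner_vec, h3 _ _ _ (hne hn)] at this
    rwa [show x * -y + y * x + z * z = z ^ 2 by ring] at this) (by
    have := (hpart (vec x y (-z)) (hunit (by linarith))).2
    rw [inner_vec, f3] at this
    rwa [show x * x + y * y + z * -z = 1 - 2 * z ^ 2 by linarith] at this)
  linarith

/-- The restriction to lines of a diagonal quadratic form is a frame function. -/
lemma diagonal (l m n : ℝ) :
    IsFrame (fun x => (l * x 0 ^ 2 + m * x 1 ^ 2 + n * x 2 ^ 2) / ‖x‖ ^ 2) (l + m + n) where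
  smul t x ht := by
    simp only [PiLp.smul_apply, smul_eq_mul, norm_smul, Real.norm_eq_abs, mul_pow, sq_abs]
    rw [← mul_div_mul_left _ (‖x‖ ^ 2) (pow_ne_zero 2 ht)]
    ring_nf
  sum x y z hx hy hz hxy hxz hyz := by
    obtain ⟨e, h0, h1, h2⟩ := exists_normalizedBasis hx hy hz hxy hxz hyz
    have hsum : ∀ i, x i ^ 2 / ‖x‖ ^ 2 + y i ^ 2 / ‖y‖ ^ 2 + z i ^ 2 / ‖z‖ ^ 2 = 1 := by
      intro i
      have hs := e.sum_sq_norm_inner_right (EuclideanSpace.single i (1 : ℝ))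
      simp only [Fin.sum_univ_three, h0, h1, h2] at hs
      simp [inner_smul_left, EuclideanSpace.inner_single_right, mul_pow] at hs
      rw [← hs]
      ring
    linear_combination l * hsum 0 + m * hsum 1 + n * hsum 2

/-- A continuous frame function is the restriction of a diagonal quadratic form in suitable
orthonormal coordinates. -/
lemma exists_diagonal (hf : IsFrame f w) (hcont : ∀ v ≠ 0, ContinuousAt f v) :
    ∃ (A : EuclideanSpace ℝ (Fin 3) ≃ₗᵢ[ℝ] EuclideanSpace ℝ (Fin 3)) (l m n : ℝ),
      ∀ v ≠ 0, f (A v) * ‖v‖ ^ 2 = l * v 0 ^ 2 + m * v 1 ^ 2 + n * v 2 ^ 2 := by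
  obtain ⟨p, -, hp, hmax⟩ := hf.exists_max hcont (K := ⊤) top_ne_bot
  replace hmax : ∀ v ≠ 0, f v ≤ f p := fun v hv => hmax v trivial hv
  obtain ⟨r, hrp, hr, hmin⟩ := hf.neg.exists_max (fun v hv => (hcont v hv).neg) (K := (ℝ ∙ p)ᗮ) (by
    obtain ⟨q, hq, hpq, -⟩ := exists_orthogonal p p
    refine (Submodule.ne_bot_iff _).2
      ⟨q, Submodule.mem_orthogonal_singleton_iff_inner_right.2 hpq, ?_⟩
    rintro rfl
    simp at hq)
  rw [Submodule.mem_orthogonal_singleton_iff_inner_left] at hrp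
  obtain ⟨A, rfl, rfl⟩ := exists_isometry hr hp hrp
  have hA : ∀ v ≠ 0, A v ≠ 0 := fun v hv => (map_ne_zero_iff A A.injective).2 hv
  obtain ⟨F, hF⟩ : ∃ F : EuclideanSpace ℝ (Fin 3) → ℝ, F = fun v => f (A v) := ⟨_, rfl⟩
  have hFf : IsFrame F w := hF ▸ hf.comp A.toLinearIsometry
  have hFc : ∀ v ≠ 0, ContinuousAt F v := fun v hv =>
    hF ▸ ContinuousAt.comp (hcont _ (hA v hv)) A.continuous.continuousAt
  have hFmax : ∀ v ≠ 0, F v ≤ F (vec 0 0 1) := fun v hv => by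
    simpa only [hF] using hmax _ (hA v hv)
  have hFeq : ∀ a b, 0 < a ^ 2 + b ^ 2 → F (vec 1 0 0) ≤ F (vec a b 0) := by
    intro a b hab
    have := hmin (A (vec a b 0)) (by
      rw [Submodule.mem_orthogonal_singleton_iff_inner_left, A.inner_map_map, inner_vec]
      ring) (hA _ ((vec_ne_zero_iff _ _ _).2 (by linarith)))
    simp only [hF]
    linarith
  have hFmin : ∀ v ≠ 0, F (vec 1 0 0) ≤ F v := by
    intro v hv
    rw [← vec_eta v] at hv ⊢
    generalize v 0 = a at *
    generalize v 1 = b at *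
    generalize v 2 = z at *
    rw [vec_ne_zero_iff] at hv
    by_cases h : 0 < a ^ 2 + b ^ 2
    · have hpos : 0 < (a * z) ^ 2 + (b * z) ^ 2 + (-(a ^ 2 + b ^ 2)) ^ 2 := by
        nlinarith [pow_pos h 2, sq_nonneg (a * z), sq_nonneg (b * z)]
      have h1 := hFf.sum_vec (a := a) (b := b) (c := z) (a' := a * z) (b' := b * z)
        (c' := -(a ^ 2 + b ^ 2)) (a'' := -b) (b'' := a) (c'' := 0) (by positivity) hpos
        (by nlinarith) (by ring) (by ring) (by ring)
      have h2 := hFf.sum_vec (a := a) (b := b) (c := 0) (a' := 0) (b' := 0)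
        (c' := 1) (a'' := -b) (b'' := a) (c'' := 0) (by linarith) (by norm_num)
        (by nlinarith) (by ring) (by ring) (by ring)
      have h3 := hFmax _ ((vec_ne_zero_iff _ _ _).2 hpos)
      have h4 := hFeq a b h
      linarith
    · have ha : a = 0 := by nlinarith
      have hb : b = 0 := by nlinarith
      subst ha hb
      rw [hFf.pole (by rintro rfl; norm_num at hv)]
      exact hFmax _ ((vec_ne_zero_iff _ _ _).2 (by norm_num))
  set l := F (vec 1 0 0) with hl
  set n := F (vec 0 0 1) with hn
  refine ⟨A, l, w - l - n, n, fun v hv => ?_⟩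
  obtain ⟨h, hh⟩ : ∃ h : EuclideanSpace ℝ (Fin 3) → ℝ, h = fun x =>
    F x + -((l * x 0 ^ 2 + (w - l - n) * x 1 ^ 2 + n * x 2 ^ 2) / ‖x‖ ^ 2) := ⟨_, rfl⟩
  have hframe : IsFrame h 0 := by
    have := hFf.add (diagonal l (w - l - n) n).neg
    rw [hh]
    convert this using 1
    ring
  have hhcont : ∀ v ≠ 0, ContinuousAt h v := by
    intro v hv
    rw [hh]
    refine (hFc v hv).add (ContinuousAt.neg (ContinuousAt.div ?_ ?_ (by simpa using hv)))
    · fun_prop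
    · fun_prop
  have hunit : ∀ a b c, a ^ 2 + b ^ 2 + c ^ 2 = 1 → h (vec a b c) =
      F (vec a b c) - (l * a ^ 2 + (w - l - n) * b ^ 2 + n * c ^ 2) := by
    intro a b c habc
    rw [hh]
    simp [norm_sq_vec, habc, sub_eq_add_neg]
  have hscale : ∀ a b c, vec a b c ≠ 0 → ∃ t a' b' c', t ≠ 0 ∧ a = t * a' ∧ b = t * b' ∧
      c = t * c' ∧ a' ^ 2 + b' ^ 2 + c' ^ 2 = 1 := by
    intro a b c habc
    have h0 : ‖vec a b c‖ ≠ 0 := norm_ne_zero_iff.2 habc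
    refine ⟨‖vec a b c‖, a / ‖vec a b c‖, b / ‖vec a b c‖, c / ‖vec a b c‖, h0, ?_, ?_, ?_, ?_⟩
    · field_simp
    · field_simp
    · field_simp
    · rw [div_pow, div_pow, div_pow, ← add_div, ← add_div, ← norm_sq_vec]
      exact div_self (pow_ne_zero 2 h0)
  have h3 : ∀ a b c, vec a b c ≠ 0 → h (vec (-b) a c) = -h (vec a b c) := by
    intro a b c habc
    obtain ⟨t, a, b, c, ht, rfl, rfl, rfl, h1⟩ := hscale a b c habc
    rw [← mul_neg, hframe.smul_vec ht, hframe.smul_vec ht, hunit _ _ _ h1,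
      hunit _ _ _ (by linarith)]
    linear_combination hFf.add_quarterTurn hFc hFmax h1 - (w - n) * h1
  have h1 : ∀ a b c, vec a b c ≠ 0 → h (vec a (-c) b) = -h (vec a b c) := by
    intro a b c habc
    obtain ⟨t, a, b, c, ht, rfl, rfl, rfl, h1⟩ := hscale a b c habc
    rw [← mul_neg, hframe.smul_vec ht, hframe.smul_vec ht, hunit _ _ _ h1,
      hunit _ _ _ (by linarith)]
    have h2 := (hFf.comp cycle).neg.add_quarterTurn
      (fun v hv => (ContinuousAt.comp (hFc _ ((map_ne_zero_iff cycle cycle.injective).2 hv))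
        cycle.continuous.continuousAt).neg)
      (fun v hv => neg_le_neg (hFmin _ ((map_ne_zero_iff cycle cycle.injective).2 hv)))
      (a := b) (b := c) (z := a) (by linarith)
    simp only [cycle_vec, ← hl] at h2
    linear_combination -h2 - (w - l) * h1
  have h0 := hframe.eq_zero_of_odd hhcont h1 h3 hv
  have hv2 : ‖v‖ ^ 2 ≠ 0 := by simpa using hv
  rw [hh] at h0
  field_simp at h0
  have e : F v = f (A v) := by rw [hF]
  rw [← e]
  linarith

/-- In a plane, a continuous frame function is the restriction of a quadratic form. -/
theorem exists_cross (hf : IsFrame f w) {b : ℝ} (hb : ∀ v ≠ 0, b ≤ f v) :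
    ∃ κ, ∀ a b : ℝ, a ^ 2 + b ^ 2 = 1 →
      f (vec a b 0) = a ^ 2 * f (vec 1 0 0) + b ^ 2 * f (vec 0 1 0) + 2 * a * b * κ := by
  obtain ⟨A, l, m, n, hA⟩ := hf.exists_diagonal fun v hv => hf.continuousAt hb hv
  have hA' : ∀ v, ‖v‖ = 1 → f v =
      l * A.symm v 0 ^ 2 + m * A.symm v 1 ^ 2 + n * A.symm v 2 ^ 2 := by
    intro v hv
    have := hA (A.symm v) (by
      rw [← norm_ne_zero_iff, A.symm.norm_map, hv]
      exact one_ne_zero)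
    simpa [hv] using this
  set p := A.symm (vec 1 0 0) with hp
  set q := A.symm (vec 0 1 0) with hq
  have hunit : ∀ a b : ℝ, a ^ 2 + b ^ 2 = 1 → ‖vec a b 0‖ = 1 := by
    intro a b h
    rw [← pow_eq_one_iff_of_nonneg (norm_nonneg _) two_ne_zero, norm_sq_vec, ← h]
    ring
  refine ⟨l * p 0 * q 0 + m * p 1 * q 1 + n * p 2 * q 2, fun a b hab => ?_⟩
  have e : A.symm (vec a b 0) = a • p + b • q := by
    rw [hp, hq, ← map_smul, ← map_smul, ← map_add]
    congr 1
    ext i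
    fin_cases i <;> simp [vec]
  rw [hA' _ (hunit _ _ hab), hA' _ (hunit 1 0 (by norm_num)), hA' _ (hunit 0 1 (by norm_num)), e]
  simp
  ring

end IsFrame

/-- A bounded function whose restrictions to planes are Hermitian forms is the quadratic form of a
positive operator. -/
theorem exists_isPositive_inner_eq {H : Type*} [NormedAddCommGroup H] [InnerProductSpace ℂ H]
    [CompleteSpace H] {F : H → ℝ} (h0 : ∀ x, 0 ≤ F x) (h1 : ∀ x, F x ≤ ‖x‖ ^ 2)
    (hF : ∀ x y, ∃ κ : ℂ, ∀ a b : ℂ,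
      F (a • x + b • y) = ‖a‖ ^ 2 * F x + ‖b‖ ^ 2 * F y + (starRingEnd ℂ a * b * κ).re) :
    ∃ ρ : H →L[ℂ] H, ρ.IsPositive ∧ ∀ x, ⟪x, ρ x⟫ = F x := by
  choose K hK using hF
  have hsmul : ∀ (c : ℂ) x, F (c • x) = ‖c‖ ^ 2 * F x := by
    intro c x
    have := hK x 0 c 0
    simpa using this
  have hadd : ∀ x y, F (x + y) = F x + F y + (K x y).re := by
    intro x y
    simpa using hK x y 1 1
  have hext : ∀ κ κ' : ℂ, (∀ a : ℂ, (starRingEnd ℂ a * κ).re = (starRingEnd ℂ a * κ').re) →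
      κ = κ' := by
    intro κ κ' h
    apply Complex.ext
    · simpa using h 1
    · simpa using h Complex.I
  have Ksmul : ∀ (c : ℂ) x y, K x (c • y) = c * K x y := by
    intro c x y
    refine hext _ _ fun a => ?_
    have e1 := hK x (c • y) a 1
    have e2 := hK x y a c
    rw [one_smul, hsmul] at e1
    rw [mul_one, norm_one] at e1
    rw [← mul_assoc]
    linarith
  have Kconj : ∀ x y, K y x = starRingEnd ℂ (K x y) := by
    intro x y
    refine hext _ _ fun a => ?_
    have e1 := hK y x a 1
    have e2 := hK x y 1 a
    rw [add_comm] at e1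
    have e3 : (starRingEnd ℂ a * starRingEnd ℂ (K x y)).re = (a * K x y).re := by
      rw [← map_mul, Complex.conj_re]
    rw [e3]
    simp only [map_one, one_mul, mul_one, norm_one] at e1 e2
    linarith
  have Ksmul_left : ∀ (c : ℂ) x y, K (c • x) y = starRingEnd ℂ c * K x y := by
    intro c x y
    rw [Kconj y, Ksmul, map_mul, ← Kconj]
  have hpar : ∀ x y, F (x + y) + F (x - y) = 2 * F x + 2 * F y := by
    intro x y
    have e1 := hK x y 1 1
    have e2 := hK x y 1 (-1)
    simp only [one_smul, neg_smul, ← sub_eq_add_neg] at e1 e2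
    simp at e1 e2
    linarith
  have Kadd_re : ∀ x y z, (K x (y + z)).re = (K x y).re + (K x z).re := by
    intro x y z
    have p1 := hpar (x + y) z
    have p2 := hpar (x + z) y
    have p3 := hpar x (y - z)
    have p4 := hpar y z
    have a1 := hadd x (y + z)
    have a2 := hadd x y
    have a3 := hadd x z
    rw [show x + z + y = x + (y + z) by abel, show x + z - y = x - (y - z) by abel] at p2
    rw [show x + y + z = x + (y + z) by abel, show x + y - z = x + (y - z) by abel] at p1
    linarith
  have Kadd : ∀ x y z, K x (y + z) = K x y + K x z := by
    intro x y z
    refine hext _ _ fun a => ?_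
    rw [← Ksmul_left, mul_add, Complex.add_re, ← Ksmul_left, ← Ksmul_left, Kadd_re]
  have Kadd_left : ∀ x y z, K (x + y) z = K x z + K y z := by
    intro x y z
    rw [Kconj z, Kadd, map_add, ← Kconj, ← Kconj]
  have Kre : ∀ x y, (K x y).re ≤ (‖x‖ + ‖y‖) ^ 2 := by
    intro x y
    have e := hadd x y
    have : ‖x + y‖ ^ 2 ≤ (‖x‖ + ‖y‖) ^ 2 := by gcongr; exact norm_add_le x y
    linarith [h1 (x + y), h0 x, h0 y]
  have Knorm : ∀ x y, ‖K x y‖ ≤ (‖x‖ + ‖y‖) ^ 2 := by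
    intro x y
    by_cases hk : K x y = 0
    · rw [hk, norm_zero]
      positivity
    have hk' : (‖K x y‖ : ℂ) ≠ 0 := by simpa using hk
    have hc : ‖(starRingEnd ℂ (K x y) / ‖K x y‖)‖ = 1 := by
      rw [norm_div, RCLike.norm_conj, Complex.norm_real, norm_norm]
      exact div_self (by simpa using hk)
    have e := Kre x ((starRingEnd ℂ (K x y) / ‖K x y‖) • y)
    rw [norm_smul, hc, one_mul, Ksmul, div_mul_eq_mul_div, mul_comm (starRingEnd ℂ _),
      Complex.mul_conj, Complex.normSq_eq_norm_sq, sq, Complex.ofReal_mul,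
      mul_div_cancel_right₀ _ hk', Complex.ofReal_re] at e
    exact e
  have Kbound : ∀ x y, ‖K x y‖ ≤ 4 * ‖x‖ * ‖y‖ := by
    intro x y
    by_cases hx : x = 0
    · have : K x y = 0 := by simpa [hx] using Ksmul_left 0 0 y
      rw [this, norm_zero]
      positivity
    by_cases hy : y = 0
    · have : K x y = 0 := by simpa [hy] using Ksmul 0 x 0
      rw [this, norm_zero]
      positivity
    have hx' : ‖x‖ ≠ 0 := by simpa using hx
    have hy' : ‖y‖ ≠ 0 := by simpa using hy
    have e := Knorm (((‖x‖)⁻¹ : ℂ) • x) (((‖y‖)⁻¹ : ℂ) • y)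
    rw [Ksmul, Ksmul_left, norm_smul, norm_smul, norm_mul, norm_mul, RCLike.norm_conj] at e
    simp only [norm_inv, Complex.norm_real, norm_norm] at e
    rw [inv_mul_cancel₀ hx', inv_mul_cancel₀ hy'] at e
    field_simp at e
    linarith
  let B₀ : H →ₗ⋆[ℂ] H →ₗ[ℂ] ℂ := LinearMap.mk₂'ₛₗ (starRingEnd ℂ) (RingHom.id ℂ)
    (fun x y => K x y / 2)
    (fun x y z => by rw [Kadd_left, add_div])
    (fun c x y => by rw [Ksmul_left, mul_div_assoc, smul_eq_mul])
    (fun x y z => by rw [Kadd, add_div])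
    (fun c x y => by rw [Ksmul, mul_div_assoc, RingHom.id_apply, smul_eq_mul])
  let B : H →L⋆[ℂ] H →L[ℂ] ℂ := B₀.mkContinuous₂ 2 (fun x y => by
    change ‖K x y / 2‖ ≤ _
    rw [norm_div, Complex.norm_ofNat]
    linarith [Kbound x y])
  have hB : ∀ x, ⟪InnerProductSpace.continuousLinearMapOfBilin B x, x⟫ = F x := by
    intro x
    rw [InnerProductSpace.continuousLinearMapOfBilin_apply]
    change K x x / 2 = F x
    have e := hadd x x
    have e2 := hsmul 2 x
    rw [two_smul, e, Complex.norm_ofNat] at e2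
    apply Complex.ext
    · rw [Complex.div_ofNat_re, Complex.ofReal_re]
      linarith
    · have := congrArg Complex.im (Kconj x x)
      rw [Complex.conj_im] at this
      rw [Complex.div_ofNat_im, Complex.ofReal_im]
      linarith
  refine ⟨InnerProductSpace.continuousLinearMapOfBilin B, ?_, fun x => ?_⟩
  · rw [ContinuousLinearMap.isPositive_iff_complex]
    intro x
    rw [hB]
    exact ⟨rfl, h0 x⟩
  · rw [← inner_conj_symm, hB, Complex.conj_ofReal]

section Projections

variable {H : Type*} [NormedAddCommGroup H] [InnerProductSpace ℂ H] [CompleteSpace H]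

lemma isProjection_starProjection (U : Submodule ℂ H) [U.HasOrthogonalProjection] :
    IsProjection U.starProjection :=
  ⟨isSelfAdjoint_starProjection U, U.isIdempotentElem_starProjection⟩

variable {Ψ : (H →L[ℂ] H) → ℝ}

namespace IsISA

lemma map_zero (hΨ : IsISA Ψ) : Ψ 0 = 0 := by
  have h0 : IsProjection (0 : H →L[ℂ] H) := ⟨IsSelfAdjoint.zero _, by simp⟩
  have := hΨ.2.2 (fun _ => 0) 0 (fun _ => h0) h0 (fun _ _ _ => by simp)
    (fun x => by simp)
  exact (summable_const_iff _).1 this.summable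

lemma hasSum (hΨ : IsISA Ψ) {κ : Type*} [Countable κ] {P : κ → H →L[ℂ] H} {Q : H →L[ℂ] H}
    (hP : ∀ i, IsProjection (P i)) (hQ : IsProjection Q)
    (ho : ∀ i j, i ≠ j → P i ∘L P j = 0) (hs : ∀ x : H, HasSum (fun i => P i x) (Q x)) :
    HasSum (fun i => Ψ (P i)) (Ψ Q) := by
  obtain ⟨e, he⟩ := Countable.exists_injective_nat κ
  have h0 : IsProjection (0 : H →L[ℂ] H) := ⟨IsSelfAdjoint.zero _, by simp⟩
  have hE : ∀ n, Function.extend e P 0 n = 0 ∨ ∃ i, e i = n ∧ Function.extend e P 0 n = P i := by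
    intro n
    by_cases hn : ∃ i, e i = n
    · obtain ⟨i, rfl⟩ := hn
      exact Or.inr ⟨i, rfl, he.extend_apply _ _ _⟩
    · exact Or.inl (Function.extend_apply' _ _ _ hn)
  have h1 := hΨ.2.2 (Function.extend e P 0) Q (fun n => by
    rcases hE n with h | ⟨i, -, h⟩
    · rwa [h]
    · rw [h]
      exact hP i) hQ (fun m n hmn => by
    rcases hE m with h | ⟨i, rfl, h⟩
    · simp [h]
    rcases hE n with h' | ⟨j, rfl, h'⟩
    · simp [h']
    rw [h, h']
    exact ho i j fun hij => hmn (by rw [hij])) (fun x => by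
    have : (fun n => Function.extend e P 0 n x) = Function.extend e (fun i => P i x) 0 := by
      funext n
      rw [Function.apply_extend (fun T : H →L[ℂ] H => T x)]
      rfl
    rw [this]
    exact (hasSum_extend_zero he).2 (hs x))
  have h2 : (fun n => Ψ (Function.extend e P 0 n)) = Function.extend e (fun i => Ψ (P i)) 0 := by
    funext n
    rw [Function.apply_extend Ψ]
    congr 1
    funext k
    exact hΨ.map_zero
  rw [h2] at h1
  exact (hasSum_extend_zero he).1 h1

/-- An ISA is additive on the lines spanned by the vectors of an orthonormal family. -/
lemma hasSum_line (hΨ : IsISA Ψ) {κ : Type*} [Countable κ] {v : κ → H} (hv : Orthonormal ℂ v)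
    {Q : H →L[ℂ] H} (hQ : IsProjection Q) (hs : ∀ x, HasSum (fun i => ⟪v i, x⟫ • v i) (Q x)) :
    HasSum (fun i => Ψ (ℂ ∙ v i).starProjection) (Ψ Q) := by
  refine hΨ.hasSum (fun i => isProjection_starProjection _) hQ (fun i j hij => ?_) (fun x => ?_)
  · ext x
    simp [Submodule.starProjection_unit_singleton ℂ (hv.1 _), inner_smul_right, hv.2 hij]
  · simpa only [Submodule.starProjection_unit_singleton ℂ (hv.1 _)] using hs x

end IsISA

/-- The complexification of a vector of `ℝ³`. -/
noncomputable def complexify (x : EuclideanSpace ℝ (Fin 3)) : EuclideanSpace ℂ (Fin 3) :=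
  WithLp.toLp 2 fun i => (x i : ℂ)

lemma inner_complexify (x y : EuclideanSpace ℝ (Fin 3)) :
    ⟪complexify x, complexify y⟫ = (inner ℝ x y : ℝ) := by
  simp [complexify, PiLp.inner_apply]

lemma complexify_smul (t : ℝ) (x : EuclideanSpace ℝ (Fin 3)) :
    complexify (t • x) = (t : ℂ) • complexify x := by
  ext i
  simp [complexify]

lemma complexify_vec (a b c : ℝ) : complexify (vec a b c) =
    (a : ℂ) • EuclideanSpace.single 0 1 + (b : ℂ) • EuclideanSpace.single 1 1 +
      (c : ℂ) • EuclideanSpace.single 2 1 := by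
  ext i
  fin_cases i <;> simp [complexify, vec]

/-- An ISA restricts to a frame function on every real three-dimensional subspace spanned by
an orthonormal triple. -/
lemma IsISA.isFrame (hΨ : IsISA Ψ) (J : EuclideanSpace ℂ (Fin 3) →ₗᵢ[ℂ] H) :
    ∃ w, IsFrame (fun x => Ψ (ℂ ∙ J (complexify x)).starProjection) w := by
  set T := J.toContinuousLinearMap with hT
  have hTT : T.adjoint ∘L T = 1 :=
    (ContinuousLinearMap.norm_map_iff_adjoint_comp_self T).1 J.norm_map
  have hQ : IsProjection (T ∘L T.adjoint) := by
    constructor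
    · rw [ContinuousLinearMap.isSelfAdjoint_iff']
      simp [ContinuousLinearMap.adjoint_comp]
    · ext x
      have := congrArg (fun S => T (S (T.adjoint x))) hTT
      simpa using this
  have hsmul : ∀ (t : ℝ) (x : EuclideanSpace ℝ (Fin 3)), t ≠ 0 →
      (ℂ ∙ J (complexify (t • x))) = ℂ ∙ J (complexify x) := by
    intro t x ht
    rw [complexify_smul, map_smul]
    exact Submodule.span_singleton_smul_eq (by simpa using ht) _
  refine ⟨Ψ (T ∘L T.adjoint), fun t x ht => ?_, fun x y z hx hy hz hxy hxz hyz => ?_⟩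
  · simp only [hsmul t x ht]
  · obtain ⟨e, h0, h1, h2⟩ := exists_normalizedBasis hx hy hz hxy hxz hyz
    have ho : Orthonormal ℂ (Set.univ.domRestrict fun i => complexify (e i)) := by
      have := orthonormal_iff_ite.1 e.orthonormal
      rw [orthonormal_iff_ite]
      rintro ⟨i, -⟩ ⟨j, -⟩
      simp only [Set.domRestrict_apply, inner_complexify, this, Subtype.mk.injEq]
      split_ifs <;> simp
    obtain ⟨b, hb⟩ := ho.exists_orthonormalBasis_extension_of_card_eq (by simp)
    replace hb : ∀ i, b i = complexify (e i) := fun i => hb i trivial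
    have hv : Orthonormal ℂ (fun i => J (b i)) := b.orthonormal.comp_linearIsometry J
    have := (hΨ.hasSum_line hv hQ fun x => by
      have e1 := congrArg J (b.sum_repr' (T.adjoint x))
      simp only [map_sum, map_smul, ContinuousLinearMap.adjoint_inner_right] at e1
      have e2 := hasSum_fintype fun i => ⟪J (b i), x⟫ • J (b i)
      exact e1 ▸ e2).unique (hasSum_fintype _)
    rw [this, Fin.sum_univ_three]
    simp only [hb, h0, h1, h2]
    simp only [hsmul _ _ (inv_ne_zero (norm_ne_zero_iff.2 hx)),
      hsmul _ _ (inv_ne_zero (norm_ne_zero_iff.2 hy)),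
      hsmul _ _ (inv_ne_zero (norm_ne_zero_iff.2 hz))]

end Projections

section Quadratic

variable {H : Type*} [NormedAddCommGroup H] [InnerProductSpace ℂ H]

lemma exists_unit_orthogonal (hdim : 3 ≤ Module.rank ℂ H) (x y : H) :
    ∃ z, ‖z‖ = 1 ∧ ⟪x, z⟫ = 0 ∧ ⟪y, z⟫ = 0 := by
  classical
  set U := Submodule.span ℂ (({x, y} : Finset H) : Set H) with hU
  have hrank : Module.rank ℂ U ≤ 2 := by
    refine (rank_span_finset_le _).trans ?_
    exact_mod_cast Finset.card_le_two
  have hbot : Uᗮ ≠ ⊥ := by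
    intro h
    rw [Submodule.orthogonal_eq_bot_iff] at h
    rw [h, rank_top] at hrank
    have := hdim.trans hrank
    norm_num at this
  obtain ⟨z, hz, hz0⟩ := Uᗮ.ne_bot_iff.1 hbot
  have hmem : ∀ v ∈ ({x, y} : Finset H), ⟪v, z⟫ = 0 := fun v hv =>
    (Submodule.mem_orthogonal _ _).1 hz v (Submodule.subset_span hv)
  refine ⟨((‖z‖⁻¹ : ℝ) : ℂ) • z, ?_, ?_, ?_⟩
  · rw [norm_smul, Complex.norm_real, norm_inv, norm_norm,
      inv_mul_cancel₀ (norm_ne_zero_iff.2 hz0)]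
  · rw [inner_smul_right, hmem x (by simp), mul_zero]
  · rw [inner_smul_right, hmem y (by simp), mul_zero]

variable {Ψ : (H →L[ℂ] H) → ℝ}

/-- The homogeneous function of degree two whose value at a unit vector is the value of `Ψ` at the
projection onto the line spanned by that vector. -/
noncomputable def lineForm (Ψ : (H →L[ℂ] H) → ℝ) (x : H) : ℝ :=
  ‖x‖ ^ 2 * Ψ (ℂ ∙ x).starProjection

lemma lineForm_of_norm_eq_one {x : H} (hx : ‖x‖ = 1) :
    lineForm Ψ x = Ψ (ℂ ∙ x).starProjection := by
  rw [lineForm, hx, one_pow, one_mul]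

lemma lineForm_smul (c : ℂ) (x : H) : lineForm Ψ (c • x) = ‖c‖ ^ 2 * lineForm Ψ x := by
  by_cases hc : c = 0
  · simp [hc, lineForm]
  · simp only [lineForm, norm_smul, Submodule.span_singleton_smul_eq (Ne.isUnit hc)]
    ring

variable [CompleteSpace H]

namespace IsISA

lemma lineForm_nonneg (hΨ : IsISA Ψ) (x : H) : 0 ≤ lineForm Ψ x :=
  mul_nonneg (sq_nonneg _) (hΨ.1 _ (isProjection_starProjection _)).1

lemma lineForm_le (hΨ : IsISA Ψ) (x : H) : lineForm Ψ x ≤ ‖x‖ ^ 2 :=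
  mul_le_of_le_one_right (sq_nonneg _) (hΨ.1 _ (isProjection_starProjection _)).2

lemma exists_lineForm_real (hΨ : IsISA Ψ) (hdim : 3 ≤ Module.rank ℂ H) {x y : H}
    (hx : ‖x‖ = 1) (hy : ‖y‖ = 1) (hxy : ⟪x, y⟫ = 0) :
    ∃ κ : ℝ, ∀ a b : ℝ, lineForm Ψ ((a : ℂ) • x + (b : ℂ) • y) =
      a ^ 2 * lineForm Ψ x + b ^ 2 * lineForm Ψ y + 2 * a * b * κ := by
  obtain ⟨z, hz, hxz, hyz⟩ := exists_unit_orthogonal hdim x y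
  have hyx : ⟪y, x⟫ = 0 := inner_eq_zero_symm.1 hxy
  have hzx : ⟪z, x⟫ = 0 := inner_eq_zero_symm.1 hxz
  have hzy : ⟪z, y⟫ = 0 := inner_eq_zero_symm.1 hyz
  have ho : Orthonormal ℂ ![x, y, z] := by
    constructor
    · intro i
      fin_cases i <;> assumption
    · intro i j
      fin_cases i <;> fin_cases j <;> simp [*]
  set e := EuclideanSpace.basisFun (Fin 3) ℂ with he
  set J₀ := e.toBasis.constr ℂ ![x, y, z] with hJ₀
  have hJe : ∀ i, J₀ (e.toBasis i) = ![x, y, z] i := fun i => Module.Basis.constr_basis _ _ _ _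
  set J := J₀.isometryOfOrthonormal (v := e.toBasis)
    (by simp) (by
      convert ho using 1
      funext i
      exact hJe i)
  have hJs : ∀ i, J (EuclideanSpace.single i 1) = ![x, y, z] i := by
    intro i
    have := hJe i
    rw [he, OrthonormalBasis.coe_toBasis, EuclideanSpace.basisFun_apply] at this
    exact this
  have hJ : ∀ a b, J (complexify (vec a b 0)) = (a : ℂ) • x + (b : ℂ) • y := by
    intro a b
    simp only [complexify_vec, map_add, map_smul, hJs]
    simp
  obtain ⟨w, hw⟩ := hΨ.isFrame J
  obtain ⟨κ, hκ⟩ := hw.exists_cross (b := 0) fun v _ =>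
    (hΨ.1 _ (isProjection_starProjection _)).1
  simp only [hJ, Complex.ofReal_one, Complex.ofReal_zero, one_smul, zero_smul, add_zero,
    zero_add] at hκ
  rw [← lineForm_of_norm_eq_one (Ψ := Ψ) hx, ← lineForm_of_norm_eq_one (Ψ := Ψ) hy] at hκ
  have hnorm : ∀ a b : ℝ, ‖(a : ℂ) • x + (b : ℂ) • y‖ ^ 2 = a ^ 2 + b ^ 2 := by
    intro a b
    rw [sq, norm_add_sq_eq_norm_sq_add_norm_sq_of_inner_eq_zero _ _ (by
      rw [inner_smul_left, inner_smul_right, hxy, mul_zero, mul_zero])]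
    simp [norm_smul, hx, hy, sq]
  refine ⟨κ, fun a b => ?_⟩
  by_cases h0 : a ^ 2 + b ^ 2 = 0
  · have ha : a = 0 := by nlinarith
    have hb : b = 0 := by nlinarith
    simp [ha, hb, lineForm]
  have hpos : 0 < a ^ 2 + b ^ 2 := lt_of_le_of_ne (by positivity) (Ne.symm h0)
  obtain ⟨r, hr⟩ : ∃ r : ℝ, r ^ 2 = a ^ 2 + b ^ 2 := ⟨_, Real.sq_sqrt hpos.le⟩
  have hr0 : r ≠ 0 := by
    rintro rfl
    exact h0 (by rw [← hr]; ring)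
  have h1 : (a / r) ^ 2 + (b / r) ^ 2 = 1 := by
    field_simp
    linarith
  have h2 : (a : ℂ) • x + (b : ℂ) • y =
      (r : ℂ) • (((a / r : ℝ) : ℂ) • x + ((b / r : ℝ) : ℂ) • y) := by
    rw [smul_add, smul_smul, smul_smul, ← Complex.ofReal_mul, ← Complex.ofReal_mul,
      mul_div_cancel₀ _ hr0, mul_div_cancel₀ _ hr0]
  have h3 : ‖((a / r : ℝ) : ℂ) • x + ((b / r : ℝ) : ℂ) • y‖ = 1 := by
    rw [← pow_eq_one_iff_of_nonneg (norm_nonneg _) two_ne_zero, hnorm, h1]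
  rw [h2, lineForm_smul, lineForm_of_norm_eq_one h3, hκ _ _ h1, Complex.norm_real,
    Real.norm_eq_abs, sq_abs]
  field_simp

lemma exists_lineForm_unimodular (hΨ : IsISA Ψ) (hdim : 3 ≤ Module.rank ℂ H) {x y : H}
    (hx : ‖x‖ = 1) (hy : ‖y‖ = 1) (hxy : ⟪x, y⟫ = 0) :
    ∃ κ : ℂ, ∀ a b : ℝ, ∀ u : ℂ, ‖u‖ = 1 → lineForm Ψ ((a : ℂ) • x + ((b : ℂ) * u) • y) =
      a ^ 2 * lineForm Ψ x + b ^ 2 * lineForm Ψ y + a * b * (u * κ).re := by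
  have hyx : ⟪y, x⟫ = 0 := inner_eq_zero_symm.1 hxy
  obtain ⟨t, ht⟩ : ∃ t : ℝ, t ^ 2 = 1 / 2 := ⟨_, Real.sq_sqrt (by norm_num)⟩
  have ht2 : ‖(t : ℂ)‖ ^ 2 = 1 / 2 := by
    rw [Complex.norm_real, Real.norm_eq_abs, sq_abs, ht]
  have hunit : ∀ ε : ℂ, ‖ε‖ = 1 → ‖(t : ℂ) • (x + ε • y)‖ = 1 := by
    intro ε hε
    rw [← pow_eq_one_iff_of_nonneg (norm_nonneg _) two_ne_zero, norm_smul, mul_pow, ht2, sq ‖_ + _‖,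
      norm_add_sq_eq_norm_sq_add_norm_sq_of_inner_eq_zero _ _ (by
        rw [inner_smul_right, hxy, mul_zero]), norm_smul, hε, hx, hy]
    norm_num
  have hX : ‖(t : ℂ) • (x + y)‖ = 1 := by simpa using hunit 1 (by simp)
  have hY : ‖Complex.I • (t : ℂ) • (x - y)‖ = 1 := by
    rw [norm_smul, Complex.norm_I, one_mul]
    simpa [sub_eq_add_neg] using hunit (-1) (by simp)
  have hXY : ⟪(t : ℂ) • (x + y), Complex.I • (t : ℂ) • (x - y)⟫ = 0 := by
    simp [hxy, hyx, hx, hy]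
  obtain ⟨μ, hμ⟩ := hΨ.exists_lineForm_real hdim hX hY hXY
  obtain ⟨β, hβ⟩ := hΨ.exists_lineForm_real hdim hx hy hxy
  simp only [lineForm_smul, ht2, Complex.norm_I] at hμ
  have e1 := hβ 1 1
  have e2 := hβ 1 (-1)
  simp only [Complex.ofReal_one, one_smul, Complex.ofReal_neg, neg_smul, ← sub_eq_add_neg] at e1 e2
  rw [e1, e2] at hμ
  refine ⟨⟨2 * β, 2 * μ⟩, fun a b u hu => ?_⟩
  obtain ⟨v, hv⟩ := IsAlgClosed.exists_pow_nat_eq (starRingEnd ℂ u) two_pos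
  have hv1 : ‖v‖ ^ 2 = 1 := by rw [← norm_pow, hv, RCLike.norm_conj, hu]
  have hvn : v.re ^ 2 + v.im ^ 2 = 1 := by
    rw [← hv1, ← Complex.normSq_eq_norm_sq, Complex.normSq_apply]
    ring
  have hu' : u = starRingEnd ℂ v ^ 2 := by rw [← map_pow, hv, Complex.conj_conj]
  have hre : u.re = v.re ^ 2 - v.im ^ 2 := by simp [hu', sq]
  have him : u.im = -(2 * v.re * v.im) := by
    simp [hu', sq]
    ring
  obtain ⟨η, hη⟩ := hΨ.exists_lineForm_real hdim hx (y := u • y)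
    (by rw [norm_smul, hu, hy, mul_one])
    (by rw [inner_smul_right, hxy, mul_zero])
  simp only [lineForm_smul, hu, smul_smul] at hη
  have h1 := hη 1 1
  have h2 := hμ v.re v.im
  have h3 : (v.re : ℂ) • (t : ℂ) • (x + y) + (v.im : ℂ) • Complex.I • (t : ℂ) • (x - y) =
      ((t : ℂ) * v) • (((1 : ℝ) : ℂ) • x + (((1 : ℝ) : ℂ) * u) • y) := by
    have hvu : v * u = starRingEnd ℂ v := by
      rw [hu', sq, ← mul_assoc, Complex.mul_conj, Complex.normSq_eq_norm_sq, hv1,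
        Complex.ofReal_one, one_mul]
    have hvr : ((t : ℂ) * v) • x = ((t : ℂ) * (v.re + v.im * Complex.I)) • x := by
      rw [Complex.re_add_im]
    have hvc : starRingEnd ℂ v = v.re - v.im * Complex.I := by
      apply Complex.ext <;> simp
    rw [Complex.ofReal_one, one_smul, one_mul, smul_add ((t : ℂ) * v), smul_smul _ u y,
      mul_assoc _ v u, hvu, hvr, hvc]
    module
  rw [h3, lineForm_smul, norm_mul, mul_pow, ht2, hv1, h1] at h2
  rw [hη, Complex.mul_re, hre, him]
  have h4 : η = β * (v.re ^ 2 - v.im ^ 2) + 2 * v.re * v.im * μ := by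
    linear_combination h2 + (lineForm Ψ x + lineForm Ψ y) / 2 * hvn
  rw [h4]
  ring

/-- The restriction of the line form to a complex plane is a Hermitian form. -/
lemma exists_lineForm_orthonormal (hΨ : IsISA Ψ) (hdim : 3 ≤ Module.rank ℂ H) {x y : H}
    (hx : ‖x‖ = 1) (hy : ‖y‖ = 1) (hxy : ⟪x, y⟫ = 0) :
    ∃ κ : ℂ, ∀ a b : ℂ, lineForm Ψ (a • x + b • y) =
      ‖a‖ ^ 2 * lineForm Ψ x + ‖b‖ ^ 2 * lineForm Ψ y + (starRingEnd ℂ a * b * κ).re := by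
  obtain ⟨κ, hκ⟩ := hΨ.exists_lineForm_unimodular hdim hx hy hxy
  have hphase : ∀ a : ℂ, ∃ u : ℂ, ‖u‖ = 1 ∧ a = ‖a‖ * u := fun a =>
    ⟨Complex.exp (a.arg * Complex.I), Complex.norm_exp_ofReal_mul_I _,
      (Complex.norm_mul_exp_arg_mul_I a).symm⟩
  refine ⟨κ, fun a b => ?_⟩
  obtain ⟨u, hu, ha⟩ := hphase a
  obtain ⟨v, hv, hb⟩ := hphase b
  have huu : u * starRingEnd ℂ u = 1 := by
    rw [Complex.mul_conj, Complex.normSq_eq_norm_sq, hu]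
    simp
  have h1 := hκ ‖a‖ ‖b‖ (starRingEnd ℂ u * v) (by rw [norm_mul, RCLike.norm_conj, hu, hv, mul_one])
  have h2 : a • x + b • y =
      u • ((‖a‖ : ℂ) • x + ((‖b‖ : ℂ) * (starRingEnd ℂ u * v)) • y) := by
    rw [smul_add, smul_smul, smul_smul]
    congr 2
    · rw [mul_comm]
      exact ha
    · linear_combination hb - ‖b‖ * v * huu
  have h3 : starRingEnd ℂ a * b * κ = ((‖a‖ * ‖b‖ : ℝ) : ℂ) * (starRingEnd ℂ u * v * κ) := by
    conv_lhs => rw [ha, hb, map_mul, Complex.conj_ofReal]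
    push_cast
    ring
  rw [h2, lineForm_smul, hu, h1, h3, Complex.re_ofReal_mul]
  ring

lemma exists_lineForm (hΨ : IsISA Ψ) (hdim : 3 ≤ Module.rank ℂ H) (x y : H) :
    ∃ κ : ℂ, ∀ a b : ℂ, lineForm Ψ (a • x + b • y) =
      ‖a‖ ^ 2 * lineForm Ψ x + ‖b‖ ^ 2 * lineForm Ψ y + (starRingEnd ℂ a * b * κ).re := by
  have hdir : ∀ e z : H, ⟪e, z⟫ = 0 → ∃ e', ‖e'‖ = 1 ∧ ⟪e, e'⟫ = 0 ∧ z = (‖z‖ : ℂ) • e' := by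
    intro e z hez
    by_cases hz : z = 0
    · obtain ⟨e', h1, h2, -⟩ := exists_unit_orthogonal hdim e e
      exact ⟨e', h1, h2, by simp [hz]⟩
    · have hz' : (‖z‖ : ℂ) ≠ 0 := by simpa using hz
      refine ⟨(‖z‖ : ℂ)⁻¹ • z, ?_, ?_, ?_⟩
      · rw [norm_smul, norm_inv, Complex.norm_real, norm_norm,
          inv_mul_cancel₀ (norm_ne_zero_iff.2 hz)]
      · rw [inner_smul_right, hez, mul_zero]
      · rw [smul_smul, mul_inv_cancel₀ hz', one_smul]
  obtain ⟨e, he, -, hxe⟩ := hdir 0 x (inner_zero_left _)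
  obtain ⟨e', he', hee', hye⟩ := hdir e (y - ⟪e, y⟫ • e) (by
    rw [inner_sub_right, inner_smul_right, inner_self_eq_norm_sq_to_K, he]
    simp)
  obtain ⟨κ, hκ⟩ := hΨ.exists_lineForm_orthonormal hdim he he' hee'
  obtain ⟨α, hα⟩ : ∃ α : ℂ, x = α • e := ⟨_, hxe⟩
  obtain ⟨β, γ, hβ⟩ : ∃ β γ : ℂ, y = β • e + γ • e' := ⟨_, _, (sub_eq_iff_eq_add'.1 hye)⟩
  have hx := hκ α 0
  have hy := hκ β γ
  rw [zero_smul, add_zero, ← hα] at hx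
  rw [← hβ] at hy
  refine ⟨2 * starRingEnd ℂ α * β * lineForm Ψ e + starRingEnd ℂ α * γ * κ, fun a b => ?_⟩
  have h1 : a • x + b • y = (a * α + b * β) • e + (b * γ) • e' := by
    rw [hα, hβ]
    module
  rw [h1, hκ, hx, hy]
  simp only [← Complex.normSq_eq_norm_sq, Complex.normSq_apply]
  simp
  ring

/-- The line form of an ISA is the quadratic form of a positive operator. -/
theorem exists_isPositive (hΨ : IsISA Ψ) (hdim : 3 ≤ Module.rank ℂ H) :
    ∃ ρ : H →L[ℂ] H, ρ.IsPositive ∧ ∀ x, ⟪x, ρ x⟫ = lineForm Ψ x :=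
  exists_isPositive_inner_eq hΨ.lineForm_nonneg hΨ.lineForm_le (hΨ.exists_lineForm hdim)

end IsISA

end Quadratic

section Trace

variable {H K : Type*} [NormedAddCommGroup H] [InnerProductSpace ℂ H]
  [NormedAddCommGroup K] [InnerProductSpace ℂ K] {ι κ : Type*}

lemma HilbertBasis.hasSum_norm_inner_sq (b : HilbertBasis ι ℂ H) (x : H) :
    HasSum (fun i => ‖⟪b i, x⟫‖ ^ 2) (‖x‖ ^ 2) := by
  have h := b.hasSum_inner_mul_inner x x
  rw [inner_self_eq_norm_sq_to_K] at h
  have h2 : (fun i => ⟪x, b i⟫ * ⟪b i, x⟫) = fun i => ((‖⟪b i, x⟫‖ ^ 2 : ℝ) : ℂ) := by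
    funext i
    rw [← inner_conj_symm, Complex.conj_mul']
    push_cast
    rfl
  rw [h2] at h
  exact Complex.hasSum_ofReal.1 (by simpa using h)

lemma inner_self_eq_ofReal_norm_sq (x : H) : ⟪x, x⟫ = ((‖x‖ ^ 2 : ℝ) : ℂ) := by
  rw [inner_self_eq_norm_sq_to_K]
  simp

lemma Orthonormal.countable_of_hilbertBasis [Countable ι] (b : HilbertBasis ι ℂ H) {v : κ → H}
    (hv : Orthonormal ℂ v) : Countable κ := by
  have h1 : ∀ i, (Function.support fun j => ‖⟪v j, b i⟫‖ ^ 2).Countable := fun i =>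
    (hv.inner_products_summable (b i)).countable_support
  refine Set.countable_univ_iff.1 ((Set.countable_iUnion h1).mono fun j _ => ?_)
  by_contra hj
  simp only [Set.mem_iUnion, Function.mem_support, not_exists, not_not] at hj
  have h2 := b.hasSum_norm_inner_sq (v j)
  simp only [norm_inner_symm (b _) (v j), hj, hv.1 j] at h2
  simpa using h2.unique hasSum_zero

lemma summable_norm_inner_sq (e : HilbertBasis ι ℂ K) {T : H →L[ℂ] K} {v : κ → H}
    (h : Summable fun j => ‖T (v j)‖ ^ 2) :
    Summable fun p : κ × ι => ‖⟪e p.2, T (v p.1)⟫‖ ^ 2 := by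
  have h1 : ∀ j, HasSum (fun i => ‖⟪e i, T (v j)⟫‖ ^ 2) (‖T (v j)‖ ^ 2) := fun j =>
    e.hasSum_norm_inner_sq (T (v j))
  refine (summable_prod_of_nonneg fun _ => by positivity).2 ⟨fun j => (h1 j).summable, ?_⟩
  simpa only [(h1 _).tsum_eq] using h

/-- The trace of the product of an operator with the projection onto a line. -/
lemma tsum_inner_starProjection_singleton (b : HilbertBasis ι ℂ H) (ρ : H →L[ℂ] H) {x : H}
    (hx : ‖x‖ = 1) : ∑' i, ⟪b i, ρ ((ℂ ∙ x).starProjection (b i))⟫ = ⟪x, ρ x⟫ := by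
  rw [← b.tsum_inner_mul_inner]
  refine tsum_congr fun i => ?_
  rw [Submodule.starProjection_unit_singleton ℂ hx, map_smul, inner_smul_right]

variable [CompleteSpace H] [CompleteSpace K]

/-- The Hilbert-Schmidt norm of the adjoint of an operator is that of the operator. -/
lemma hasSum_norm_adjoint_sq (b : HilbertBasis κ ℂ H) (e : HilbertBasis ι ℂ K) {T : H →L[ℂ] K}
    {s : ℝ} (h : HasSum (fun j => ‖T (b j)‖ ^ 2) s) :
    HasSum (fun i => ‖T.adjoint (e i)‖ ^ 2) s := by
  have h1 := summable_norm_inner_sq e h.summable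
  have h2 : ∀ i, HasSum (fun j => ‖⟪e i, T (b j)⟫‖ ^ 2) (‖T.adjoint (e i)‖ ^ 2) := fun i => by
    simpa only [ContinuousLinearMap.adjoint_inner_right, norm_inner_symm _ (e i)] using
      b.hasSum_norm_inner_sq (T.adjoint (e i))
  have h3 := h1.hasSum.prod_fiberwise fun j => e.hasSum_norm_inner_sq (T (b j))
  have h4 := h1.prod_symm.hasSum.prod_fiberwise h2
  rw [h.unique h3, ← (Equiv.prodComm κ ι).symm.tsum_eq]
  exact h4

/-- Cyclicity of the trace for a product of two Hilbert-Schmidt operators. -/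
lemma tsum_inner_adjoint (b : HilbertBasis ι ℂ H) {S T : H →L[ℂ] H}
    (hS : Summable fun i => ‖S (b i)‖ ^ 2) (hT : Summable fun i => ‖T (b i)‖ ^ 2) :
    ∑' i, ⟪S (b i), T (b i)⟫ = ∑' k, ⟪T.adjoint (b k), S.adjoint (b k)⟫ := by
  have h1 := summable_norm_inner_sq b hS
  have h2 := summable_norm_inner_sq b hT
  have h3 : Summable (Function.uncurry fun i k => ⟪S (b i), b k⟫ * ⟪b k, T (b i)⟫) := by
    refine Summable.of_norm_bounded (h1.add h2) fun p => ?_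
    rw [Function.uncurry_def, norm_mul, norm_inner_symm]
    nlinarith [sq_nonneg (‖⟪b p.2, S (b p.1)⟫‖ - ‖⟪b p.2, T (b p.1)⟫‖),
      sq_nonneg ‖⟪b p.2, S (b p.1)⟫‖, sq_nonneg ‖⟪b p.2, T (b p.1)⟫‖]
  have h4 := h3.tsum_comm
  simp only [b.tsum_inner_mul_inner] at h4
  rw [← h4]
  refine tsum_congr fun k => ?_
  rw [← b.tsum_inner_mul_inner]
  refine tsum_congr fun i => ?_
  rw [ContinuousLinearMap.adjoint_inner_left, ContinuousLinearMap.adjoint_inner_right, mul_comm]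

variable {Ψ : (H →L[ℂ] H) → ℝ}

namespace IsISA

lemma hasSum_lineForm (hΨ : IsISA Ψ) [Countable κ] {v : κ → H} (hv : Orthonormal ℂ v)
    {Q : H →L[ℂ] H} (hQ : IsProjection Q) (hs : ∀ x, HasSum (fun i => ⟪v i, x⟫ • v i) (Q x)) :
    HasSum (fun i => lineForm Ψ (v i)) (Ψ Q) := by
  simpa only [lineForm_of_norm_eq_one (hv.1 _)] using hΨ.hasSum_line hv hQ hs

lemma hasSum_lineForm_hilbertBasis (hΨ : IsISA Ψ) [Countable ι] (b : HilbertBasis ι ℂ H) :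
    HasSum (fun i => lineForm Ψ (b i)) 1 := by
  have h1 : IsProjection (1 : H →L[ℂ] H) := ⟨IsSelfAdjoint.one _, by ext x; simp⟩
  have := hΨ.hasSum_lineForm b.orthonormal h1 fun x => by
    simpa only [b.repr_apply_apply, one_apply_eq_self] using b.hasSum_repr x
  rwa [hΨ.2.1] at this

/-- If the quadratic form of a positive operator `ρ` is the line form of an ISA, then the ISA is
given by the trace formula. -/
lemma eq_re_trace (hΨ : IsISA Ψ) [Countable ι] (b : HilbertBasis ι ℂ H) {ρ : H →L[ℂ] H}
    (hρ : ρ.IsPositive) (h : ∀ x, ⟪x, ρ x⟫ = lineForm Ψ x) {P : H →L[ℂ] H}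
    (hP : IsProjection P) : Ψ P = (∑' i, ⟪b i, ρ (P (b i))⟫).re := by
  obtain ⟨R, rfl⟩ := CStarAlgebra.nonneg_iff_eq_star_mul_self.1
    ((ContinuousLinearMap.nonneg_iff_isPositive ρ).2 hρ)
  rw [ContinuousLinearMap.star_eq_adjoint] at *
  have hR : ∀ x, ‖R x‖ ^ 2 = lineForm Ψ x := by
    intro x
    have := h x
    rw [mul_apply_eq_comp, ContinuousLinearMap.adjoint_inner_right,
      inner_self_eq_ofReal_norm_sq] at this
    exact Complex.ofReal_injective this
  have hsR : HasSum (fun i => ‖R (b i)‖ ^ 2) 1 := by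
    simpa only [hR] using hΨ.hasSum_lineForm_hilbertBasis b
  obtain ⟨_, hPU⟩ := isStarProjection_iff_eq_starProjection_range.1
    (⟨hP.2, hP.1⟩ : IsStarProjection P)
  set U := P.range with hU
  have : CompleteSpace U :=
    (ContinuousLinearMap.IsIdempotentElem.isClosed_range hP.2).completeSpace_coe
  obtain ⟨w, e, -⟩ := exists_hilbertBasis ℂ U
  have he : Orthonormal ℂ fun j => (e j : H) := e.orthonormal.comp_linearIsometry U.subtypeₗᵢ
  have := he.countable_of_hilbertBasis b
  have h1 : HasSum (fun j => lineForm Ψ (e j : H)) (Ψ P) := by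
    refine hΨ.hasSum_lineForm he hP fun x => ?_
    have h2 := e.hasSum_orthogonalProjectionOnto x
    have h3 := h2.mapL U.subtypeL
    rw [hPU]
    simpa using h3
  have h2 : HasSum (fun j => ‖(R ∘L U.subtypeL) (e j)‖ ^ 2) (Ψ P) := by
    simpa [hR] using h1
  have h3 := hasSum_norm_adjoint_sq e b h2
  have h4 : ∀ x, ‖(R ∘L U.subtypeL).adjoint x‖ = ‖(R ∘L P).adjoint x‖ := by
    intro x
    rw [ContinuousLinearMap.adjoint_comp, ContinuousLinearMap.adjoint_comp,
      ContinuousLinearMap.isSelfAdjoint_iff'.1 hP.1, hPU, Submodule.adjoint_subtypeL]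
    rfl
  simp only [h4] at h3
  have h5 := hasSum_norm_adjoint_sq b b h3
  rw [ContinuousLinearMap.adjoint_adjoint] at h5
  have h6 := tsum_inner_adjoint b hsR.summable h5.summable
  have h7 : ∀ x, ⟪(R ∘L P).adjoint x, R.adjoint x⟫ = ((‖(R ∘L P).adjoint x‖ ^ 2 : ℝ) : ℂ) := by
    intro x
    have hPP : ∀ y, P (P y) = P y := fun y => congrArg (fun A => A y) hP.2
    have hPa := ContinuousLinearMap.isSelfAdjoint_iff'.1 hP.1
    rw [ContinuousLinearMap.adjoint_comp, hPa, ContinuousLinearMap.comp_apply]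
    rw [← inner_self_eq_ofReal_norm_sq]
    nth_rw 1 [← hPP]
    nth_rw 1 [← hPa]
    rw [ContinuousLinearMap.adjoint_inner_left]
  simp only [h7] at h6
  rw [(Complex.hasSum_ofReal.2 h3).tsum_eq] at h6
  simp only [mul_apply_eq_comp, ContinuousLinearMap.adjoint_inner_right]
  simp only [ContinuousLinearMap.comp_apply] at h6
  rw [h6, Complex.ofReal_re]

end IsISA

lemma ContinuousLinearMap.IsPositive.inner_eq_lineForm (b : HilbertBasis ι ℂ H) {ρ : H →L[ℂ] H}
    (hρ : ρ.IsPositive) (h : ∀ P : H →L[ℂ] H, IsProjection P →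
      Ψ P = (∑' i, ⟪b i, ρ (P (b i))⟫).re) (x : H) : ⟪x, ρ x⟫ = lineForm Ψ x := by
  have hre : ⟪x, ρ x⟫ = ((⟪x, ρ x⟫.re : ℝ) : ℂ) := by
    refine (Complex.conj_eq_iff_re.1 ?_).symm
    rw [inner_conj_symm]
    exact hρ.isSymmetric x x
  rw [hre]
  congr 1
  by_cases hx : x = 0
  · simp [hx, lineForm]
  have hn : (‖x‖ : ℂ) ≠ 0 := by simpa using hx
  obtain ⟨u, hu, hxu⟩ : ∃ u : H, ‖u‖ = 1 ∧ x = (‖x‖ : ℂ) • u := by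
    refine ⟨(‖x‖ : ℂ)⁻¹ • x, ?_, ?_⟩
    · rw [norm_smul, norm_inv, Complex.norm_real, norm_norm,
        inv_mul_cancel₀ (norm_ne_zero_iff.2 hx)]
    · rw [smul_smul, mul_inv_cancel₀ hn, one_smul]
  have h1 := h _ (isProjection_starProjection (ℂ ∙ u))
  rw [tsum_inner_starProjection_singleton b ρ hu] at h1
  have h2 : (ℂ ∙ x) = ℂ ∙ u := by
    rw [hxu]
    exact Submodule.span_singleton_smul_eq (by simpa using hx) _
  rw [lineForm]
  simp only [h2, h1]
  conv_lhs => rw [hxu, map_smul, inner_smul_left, inner_smul_right, Complex.conj_ofReal,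
    Complex.re_ofReal_mul, Complex.re_ofReal_mul]
  ring

end Trace

/-- **Gleason's theorem.** Let `H` be a separable complex Hilbert space
(separability being witnessed by a Hilbert basis `b` indexed by a countable type) with
`dim H ≥ 3` (possibly infinite). For every Intensive State of Affairs `Ψ` on `H` there exists a
unique positive self-adjoint trace-class operator `ρ` of trace `1` such that
`Ψ P = Tr (ρ P)` for every orthogonal projection `P`. Hence positive self-adjoint trace-class
operators of trace `1` are in bijective correspondence with Intensive States of Affairs. -/
theorem gleason_existence_uniqueness {H : Type*} [NormedAddCommGroup H] [InnerProductSpace ℂ H]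
    [CompleteSpace H] {ι : Type*} [Countable ι] (b : HilbertBasis ι ℂ H)
    (hdim : 3 ≤ Module.rank ℂ H)
    (Ψ : (H →L[ℂ] H) → ℝ) (hΨ : IsISA Ψ) :
    ∃! ρ : H →L[ℂ] H, ρ.IsPositive ∧ (Summable fun i => ⟪b i, ρ (b i)⟫) ∧
      (∑' i, ⟪b i, ρ (b i)⟫) = 1 ∧
      ∀ P : H →L[ℂ] H, IsProjection P → Ψ P = (∑' i, ⟪b i, ρ (P (b i))⟫).re := by
  obtain ⟨ρ, hρ, h⟩ := hΨ.exists_isPositive hdim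
  have hs : HasSum (fun i => ⟪b i, ρ (b i)⟫) 1 := by
    simp only [h]
    simpa only [Complex.ofReal_one] using
      Complex.hasSum_ofReal.2 (hΨ.hasSum_lineForm_hilbertBasis b)
  refine ⟨ρ, ⟨hρ, hs.summable, hs.tsum_eq, fun P hP => hΨ.eq_re_trace b hρ h hP⟩, ?_⟩
  rintro σ ⟨hσ, -, -, h'⟩
  refine ContinuousLinearMap.coe_injective ((ext_inner_map _ _).1 fun x => ?_)
  rw [← inner_conj_symm, ← inner_conj_symm _ x]
  exact congrArg _ ((hσ.inner_eq_lineForm b h' x).trans (h x).symm)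
end

section
/- (Majorization criterion for separability.) Let ρ be a separable density matrix on ℂⁿ ⊗ ℂᵐ (indexed by Fin n × Fin m) and let ρ_A = Tr₂(ρ) be its reduced state. Then the eigenvalue vector of ρ is majorized by the eigenvalue vector of ρ_A: if p₁ ≥ p₂ ≥ … are the eigenvalues of ρ in decreasing order and q₁ ≥ q₂ ≥ … those of ρ_A (padded with zeros to the same length), then ∑_{i≤k} pᵢ ≤ ∑_{i≤k} qᵢ for every k, with equality for the full sums. -/
open Matrix
open scoped Kronecker ComplexOrder

/-- A density matrix: a Hermitian positive semidefinite complex matrix of trace `1`. -/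
def IsDensityMatrix {ι : Type*} [Fintype ι] [DecidableEq ι] (ρ : Matrix ι ι ℂ) : Prop :=
  ρ.PosSemidef ∧ ρ.trace = 1

open scoped Classical in
/-- The eigenvalues (counted with multiplicity) of a Hermitian complex matrix,
as a real-valued family; junk value `0` on non-Hermitian matrices. -/
noncomputable def eigs {ι : Type*} [Fintype ι] [DecidableEq ι] (ρ : Matrix ι ι ℂ) : ι → ℝ :=
  if h : ρ.IsHermitian then h.eigenvalues else 0

/-- The von Neumann entropy `S(ρ) = -∑ᵢ λᵢ log λᵢ` of a Hermitian matrix, where `(λᵢ)` are the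
eigenvalues counted with multiplicity (note `Real.log 0 = 0`, so `0 * log 0 = 0`). -/
noncomputable def vnEntropy {ι : Type*} [Fintype ι] [DecidableEq ι] (ρ : Matrix ι ι ℂ) : ℝ :=
  -∑ i, eigs ρ i * Real.log (eigs ρ i)

/-- The partial trace over the second tensor factor: `(Tr₂ ρ)(i,j) = ∑ₖ ρ((i,k),(j,k))`. -/
noncomputable def ptrace2 {n m : ℕ} (ρ : Matrix (Fin n × Fin m) (Fin n × Fin m) ℂ) :
    Matrix (Fin n) (Fin n) ℂ :=
  Matrix.of fun i j => ∑ k, ρ (i, k) (j, k)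

/-- The partial trace over the first tensor factor: `(Tr₁ ρ)(i,j) = ∑ₖ ρ((k,i),(k,j))`. -/
noncomputable def ptrace1 {n m : ℕ} (ρ : Matrix (Fin n × Fin m) (Fin n × Fin m) ℂ) :
    Matrix (Fin m) (Fin m) ℂ :=
  Matrix.of fun i j => ∑ k, ρ (k, i) (k, j)

/-- A density matrix on `ℂⁿ ⊗ ℂᵐ` is separable if it is a finite convex combination of Kronecker
products of density matrices on the factors; otherwise it is entangled. -/
def IsSeparableState {n m : ℕ} (ρ : Matrix (Fin n × Fin m) (Fin n × Fin m) ℂ) : Prop :=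
  ∃ (N : ℕ) (p : Fin N → ℝ) (σ : Fin N → Matrix (Fin n) (Fin n) ℂ)
    (τ : Fin N → Matrix (Fin m) (Fin m) ℂ),
    (∀ i, 0 ≤ p i) ∧ (∑ i, p i = 1) ∧ (∀ i, IsDensityMatrix (σ i)) ∧
    (∀ i, IsDensityMatrix (τ i)) ∧ ρ = ∑ i, (p i : ℂ) • (σ i ⊗ₖ τ i)

theorem sum_filter_lt_le_of_doubly_substochastic {N : ℕ} (D : Fin N → Fin N → ℝ) (f g : Fin N → ℝ)
    (hD : ∀ i j, 0 ≤ D i j) (hrow : ∀ i, ∑ j, D i j ≤ 1) (hcol : ∀ j, ∑ i, D i j ≤ 1)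
    (hg : ∀ j, 0 ≤ g j) (hga : Antitone g) (hf : ∀ i, f i = ∑ j, D i j * g j) (k : ℕ) :
    ∑ i with i.val < k, f i ≤ ∑ i with i.val < k, g i := by
  set S : Finset (Fin N) := {i | i.val < k} with hS
  set w : Fin N → ℝ := fun j => ∑ i ∈ S, D i j with hw
  have hw0 (j) : 0 ≤ w j := Finset.sum_nonneg fun i _ => hD i j
  have hw1 (j) : w j ≤ 1 :=
    (Finset.sum_le_univ_sum_of_nonneg fun i => hD i j).trans (hcol j)
  have hws : ∑ j, w j ≤ ∑ j, if j ∈ S then (1 : ℝ) else 0 := by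
    rw [hw, Finset.sum_comm, Finset.sum_ite_mem, Finset.univ_inter]
    exact Finset.sum_le_sum fun i _ => hrow i
  have hfw : ∑ i ∈ S, f i = ∑ j, w j * g j := by
    simp only [hf, hw, Finset.sum_mul]
    exact Finset.sum_comm
  have hgS : ∑ i ∈ S, g i = ∑ j, (if j ∈ S then 1 else 0) * g j := by simp
  obtain ⟨t, ht, htS, htS'⟩ : ∃ t : ℝ, 0 ≤ t ∧ (∀ j ∈ S, t ≤ g j) ∧ ∀ j ∉ S, g j ≤ t := by
    by_cases hk : k < N
    · refine ⟨g ⟨k, hk⟩, hg _, fun j hj => hga ?_, fun j hj => hga ?_⟩ <;>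
        simp [hS, Fin.le_def] at hj ⊢ <;> omega
    · exact ⟨0, le_rfl, fun j _ => hg j, fun j hj => absurd (by simp [hS]; omega) hj⟩
  have key : ∑ j, w j * (g j - t) ≤ ∑ j, (if j ∈ S then 1 else 0) * (g j - t) := by
    refine Finset.sum_le_sum fun j _ => ?_
    split_ifs with hj
    · exact mul_le_mul_of_nonneg_right (hw1 j) (sub_nonneg.2 (htS j hj))
    · rw [zero_mul]
      exact mul_nonpos_of_nonneg_of_nonpos (hw0 j) (sub_nonpos.2 (htS' j hj))
  simp only [mul_sub, Finset.sum_sub_distrib, ← Finset.sum_mul] at key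
  rw [hfw, hgS]
  linarith [mul_le_mul_of_nonneg_right hws ht]

theorem Fin.sum_dite_lt {n N : ℕ} (h : n ≤ N) (F : Fin n → ℝ) :
    (∑ i : Fin N, if hi : i.val < n then F ⟨i.val, hi⟩ else 0) = ∑ i, F i := by
  symm
  refine Finset.sum_of_injOn (Fin.castLE h) (Fin.castLE_injective h).injOn (by simp) ?_ ?_
  · intro i _ hi
    rw [dif_neg]
    intro hn
    exact hi ⟨⟨i, hn⟩, by simp, rfl⟩
  · intro i _
    simp

section
open scoped Matrix.Norms.L2Operator

variable {I J : Type*} [Fintype I] [Fintype J] [DecidableEq J]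

theorem sum_norm_sq_mulVec_le (C : Matrix I J ℂ) (h : ‖C‖ ≤ 1) (v : J → ℂ) :
    ∑ i, ‖(C *ᵥ v) i‖ ^ 2 ≤ ∑ j, ‖v j‖ ^ 2 := by
  have := (C.l2_opNorm_mulVec (WithLp.toLp 2 v)).trans
    (mul_le_of_le_one_left (norm_nonneg _) h)
  have := pow_le_pow_left₀ (norm_nonneg _) this 2
  simpa [EuclideanSpace.norm_sq_eq] using this

theorem sum_norm_sq_unitary_mulVec (U : Matrix.unitaryGroup J ℂ) (v : J → ℂ) :
    ∑ i, ‖(U.1 *ᵥ v) i‖ ^ 2 = ∑ i, ‖v i‖ ^ 2 := by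
  have hst (v : J → ℂ) : ((∑ i, ‖v i‖ ^ 2 : ℝ) : ℂ) = star v ⬝ᵥ v := by
    simp [dotProduct, Complex.conj_mul']
  rw [← Complex.ofReal_inj, hst, hst, star_mulVec, dotProduct_mulVec, vecMul_vecMul,
    ← star_eq_conjTranspose, Unitary.coe_star_mul_self, vecMul_one]

/-- A singular value decomposition of `M` relative to the eigenbasis of `M * Mᴴ`, with a
contraction in place of the right partial isometry. -/
theorem exists_contraction_eq_eigenvectorUnitary_mul [DecidableEq I] (M : Matrix I J ℂ)
    (h : (M * Mᴴ).IsHermitian) :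
    ∃ C : Matrix I J ℂ, ‖C‖ ≤ 1 ∧
      M = h.eigenvectorUnitary.1 * (diagonal (fun i => (√(h.eigenvalues i) : ℂ)) * C) ∧
      M * Cᴴ = h.eigenvectorUnitary.1 * diagonal (fun i => (√(h.eigenvalues i) : ℂ)) := by
  set U := h.eigenvectorUnitary.1
  set l := h.eigenvalues with hl
  have hl0 (i) : 0 ≤ l i := (posSemidef_self_mul_conjTranspose M).eigenvalues_nonneg i
  have hUU : Uᴴ * U = 1 := Unitary.coe_star_mul_self h.eigenvectorUnitary
  have hUU' : U * Uᴴ = 1 := Unitary.coe_mul_star_self h.eigenvectorUnitary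
  have hspec : M * Mᴴ = U * diagonal (fun i => (l i : ℂ)) * Uᴴ := by
    conv_lhs => rw [h.spectral_theorem, Unitary.conjStarAlgAut_apply]
    rfl
  have hMU : M * (Mᴴ * U) = U * diagonal (fun i => (l i : ℂ)) := by
    rw [← Matrix.mul_assoc, hspec, Matrix.mul_assoc, hUU, Matrix.mul_one]
  have hE : (diagonal (fun i => ((√(l i))⁻¹ : ℂ)))ᴴ = diagonal (fun i => ((√(l i))⁻¹ : ℂ)) := by
    rw [diagonal_conjTranspose]
    congr 1
    ext i
    simp
  have hC : (diagonal (fun i => ((√(l i))⁻¹ : ℂ)) * (Uᴴ * M))ᴴ =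
      Mᴴ * U * diagonal (fun i => ((√(l i))⁻¹ : ℂ)) := by
    rw [conjTranspose_mul, hE, conjTranspose_mul, conjTranspose_conjTranspose]
  refine ⟨diagonal (fun i => ((√(l i))⁻¹ : ℂ)) * (Uᴴ * M), ?_, ?_, ?_⟩
  · rw [← l2_opNorm_conjTranspose, ← sq_le_one_iff₀ (norm_nonneg _), sq,
      ← l2_opNorm_conjTranspose_mul_self, conjTranspose_conjTranspose, hC]
    have : diagonal (fun i => ((√(l i))⁻¹ : ℂ)) * (Uᴴ * M) *
        (Mᴴ * U * diagonal (fun i => ((√(l i))⁻¹ : ℂ))) =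
        diagonal (fun i => (((√(l i))⁻¹ * l i * (√(l i))⁻¹ : ℝ) : ℂ)) := by
      calc _ = diagonal (fun i => ((√(l i))⁻¹ : ℂ)) * (Uᴴ * (M * (Mᴴ * U))) *
            diagonal (fun i => ((√(l i))⁻¹ : ℂ)) := by simp only [Matrix.mul_assoc]
        _ = _ := by
          rw [hMU, ← Matrix.mul_assoc Uᴴ, hUU, Matrix.one_mul, diagonal_mul_diagonal,
            diagonal_mul_diagonal]
          simp
    rw [this, l2_opNorm_diagonal, pi_norm_le_iff_of_nonneg zero_le_one]
    intro i
    rw [Complex.norm_real, Real.norm_eq_abs]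
    by_cases hi : l i = 0
    · simp [hi]
    · have : (√(l i))⁻¹ * l i * (√(l i))⁻¹ = 1 := by
        have h1 := Real.mul_self_sqrt (hl0 i)
        have h2 : √(l i) ≠ 0 := (Real.sqrt_ne_zero (hl0 i)).2 hi
        field_simp
        linarith
      simp [this]
  · have hB : diagonal (fun i => (√(l i) : ℂ)) * (diagonal (fun i => ((√(l i))⁻¹ : ℂ)) * (Uᴴ * M))
        = Uᴴ * M := by
      rw [← Matrix.mul_assoc, diagonal_mul_diagonal]
      ext i j
      rw [diagonal_mul]
      by_cases hi : l i = 0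
      · have hrow : ((Uᴴ * M) * (Uᴴ * M)ᴴ) i i = 0 := by
          rw [conjTranspose_mul, conjTranspose_conjTranspose, Matrix.mul_assoc, hMU,
            ← Matrix.mul_assoc, hUU, Matrix.one_mul, diagonal_apply_eq, hi, Complex.ofReal_zero]
        rw [mul_apply] at hrow
        have := (Finset.sum_eq_zero_iff_of_nonneg fun j _ => by
          rw [conjTranspose_apply]; exact mul_star_self_nonneg _).1 hrow j (Finset.mem_univ _)
        rw [conjTranspose_apply, CStarRing.mul_star_self_eq_zero_iff] at this
        rw [this, mul_zero]
      · have h2 : (√(l i) : ℂ) ≠ 0 := by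
          exact_mod_cast (Real.sqrt_ne_zero (hl0 i)).2 hi
        rw [mul_inv_cancel₀ h2, one_mul]
    rw [hB, ← Matrix.mul_assoc, hUU', Matrix.one_mul]
  · rw [hC, ← Matrix.mul_assoc, hMU, Matrix.mul_assoc, diagonal_mul_diagonal]
    congr 2
    ext i
    rw [← div_eq_mul_inv, ← Complex.ofReal_div, Real.div_sqrt]

theorem sum_norm_sq_row_le [DecidableEq I] (C : Matrix I J ℂ) (h : ‖C‖ ≤ 1) (i : I) :
    ∑ j, ‖C i j‖ ^ 2 ≤ 1 := by
  have := sum_norm_sq_mulVec_le Cᴴ ((l2_opNorm_conjTranspose C).trans_le h) (Pi.single i 1)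
  simpa [Pi.single_apply, apply_ite, ite_pow] using this

/-- If the columns of `V` are product vectors `A j ⊗ B j` with `B j` of norm one, then the spectrum
of `V * Vᴴ` is the image of that of `A * Aᴴ` under a doubly substochastic matrix. -/
theorem exists_doubly_substochastic {K : Type*} [Fintype K] [DecidableEq I] [DecidableEq K]
    (A : Matrix I J ℂ) (B : Matrix K J ℂ) (hB : ∀ j, ∑ k, ‖B k j‖ ^ 2 = 1)
    (V : Matrix (I × K) J ℂ) (hV : ∀ x j, V x j = A x.1 j * B x.2 j)
    (h : (V * Vᴴ).IsHermitian) (hA : (A * Aᴴ).IsHermitian) :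
    ∃ D : I × K → I → ℝ, (∀ r i, 0 ≤ D r i) ∧ (∀ r, ∑ i, D r i ≤ 1) ∧ (∀ i, ∑ r, D r i ≤ 1) ∧
      ∀ r, h.eigenvalues r = ∑ i, D r i * hA.eigenvalues i := by
  obtain ⟨C, hC, -, hVC⟩ := exists_contraction_eq_eigenvectorUnitary_mul V h
  obtain ⟨E, hE, hAE, -⟩ := exists_contraction_eq_eigenvectorUnitary_mul A hA
  have hl0 (r) : 0 ≤ h.eigenvalues r := (posSemidef_self_mul_conjTranspose V).eigenvalues_nonneg r
  have hm0 (r) : 0 ≤ hA.eigenvalues r := (posSemidef_self_mul_conjTranspose A).eigenvalues_nonneg r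
  refine ⟨fun r i => ∑ k, ‖(E *ᵥ fun j => B k j * star (C r j)) i‖ ^ 2,
    fun r i => by positivity, fun r => ?_, fun i => ?_, fun r => ?_⟩
  · rw [Finset.sum_comm]
    refine (Finset.sum_le_sum fun k _ => sum_norm_sq_mulVec_le E hE _).trans ?_
    rw [Finset.sum_comm]
    simp only [norm_mul, norm_star, mul_pow, ← Finset.sum_mul, hB, one_mul]
    exact sum_norm_sq_row_le C hC r
  · rw [Finset.sum_comm]
    have hk (k : K) : ∑ r, ‖(E *ᵥ fun j => B k j * star (C r j)) i‖ ^ 2 ≤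
        ∑ j, ‖B k j‖ ^ 2 * ‖E i j‖ ^ 2 := by
      refine (Eq.le ?_).trans
        ((sum_norm_sq_mulVec_le C hC fun j => star (B k j * E i j)).trans_eq ?_)
      · refine Finset.sum_congr rfl fun r _ => ?_
        rw [← norm_star]
        simp only [mulVec, dotProduct, star_sum, star_mul', star_star]
        congr 2
        exact Finset.sum_congr rfl fun j _ => by ring
      · simp [mul_pow]
    refine (Finset.sum_le_sum fun k _ => hk k).trans ?_
    rw [Finset.sum_comm]
    simp only [← Finset.sum_mul, hB, one_mul]
    exact sum_norm_sq_row_le E hE i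
  · have h1 : h.eigenvalues r = ∑ x, ‖(V * Cᴴ) x r‖ ^ 2 := by
      have := sum_norm_sq_unitary_mulVec h.eigenvectorUnitary (Pi.single r (√(h.eigenvalues r) : ℂ))
      rw [hVC]
      simp only [mul_diagonal]
      simpa [Pi.single_apply, apply_ite, ite_pow, Real.sq_sqrt (hl0 r), mul_comm] using this.symm
    have h2 (i : I) (k : K) : (V * Cᴴ) (i, k) r = (A *ᵥ fun j => B k j * star (C r j)) i := by
      simp [mul_apply, mulVec, dotProduct, hV, mul_assoc]
    rw [h1, Fintype.sum_prod_type_right]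
    simp only [h2, Finset.sum_mul]
    rw [Finset.sum_comm (s := (Finset.univ : Finset I))]
    refine Finset.sum_congr rfl fun k _ => ?_
    conv_lhs => rw [hAE, ← mulVec_mulVec, sum_norm_sq_unitary_mulVec]
    refine Finset.sum_congr rfl fun i _ => ?_
    rw [← mulVec_mulVec, mulVec_diagonal, norm_mul, mul_pow, Complex.norm_real, Real.norm_eq_abs,
      sq_abs, Real.sq_sqrt (hm0 i), mul_comm]

end

theorem Matrix.PosSemidef.exists_sum_rankOne {I : Type*} [Fintype I] [DecidableEq I]
    {A : Matrix I I ℂ} (h : A.PosSemidef) :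
    ∃ (w : I → ℝ) (v : I → I → ℂ), (∀ t, 0 ≤ w t) ∧ (∀ t, ∑ x, ‖v t x‖ ^ 2 = 1) ∧
      ∀ x y, A x y = ∑ t, w t * v t x * star (v t y) := by
  refine ⟨h.1.eigenvalues, fun t => h.1.eigenvectorBasis t, h.eigenvalues_nonneg, fun t => ?_,
    fun x y => ?_⟩
  · rw [← EuclideanSpace.norm_sq_eq, OrthonormalBasis.norm_eq_one, one_pow]
  · conv_lhs => rw [h.1.spectral_theorem, Unitary.conjStarAlgAut_apply]
    rw [mul_apply]
    refine Finset.sum_congr rfl fun t _ => ?_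
    rw [mul_diagonal]
    simp [star_apply, mul_comm]

theorem IsSeparableState.exists_product_vectors {n m : ℕ}
    {ρ : Matrix (Fin n × Fin m) (Fin n × Fin m) ℂ} (h : IsSeparableState ρ) :
    ∃ (N : ℕ) (A : Matrix (Fin n) (Fin N × Fin n × Fin m) ℂ)
      (B : Matrix (Fin m) (Fin N × Fin n × Fin m) ℂ), (∀ j, ∑ k, ‖B k j‖ ^ 2 = 1) ∧
      ∀ x y, ρ x y = ∑ j, (A x.1 j * B x.2 j) * star (A y.1 j * B y.2 j) := by
  obtain ⟨N, p, σ, τ, hp, -, hσ, hτ, rfl⟩ := h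
  choose w v hw _ hσv using fun i => (hσ i).1.exists_sum_rankOne
  choose z u hz hu hτu using fun i => (hτ i).1.exists_sum_rankOne
  refine ⟨N, of fun x j => (√(p j.1 * w j.1 j.2.1 * z j.1 j.2.2) : ℂ) * v j.1 j.2.1 x,
    of fun k j => u j.1 j.2.2 k, fun j => hu _ _, fun x y => ?_⟩
  rw [Matrix.sum_apply, Fintype.sum_prod_type]
  refine Finset.sum_congr rfl fun i _ => ?_
  rw [Matrix.smul_apply, kroneckerMap_apply, hσv, hτu, Finset.sum_mul_sum, Fintype.sum_prod_type,
    Finset.smul_sum]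
  refine Finset.sum_congr rfl fun s _ => ?_
  rw [Finset.smul_sum]
  refine Finset.sum_congr rfl fun t _ => ?_
  have hsq : (√(p i * w i s * z i t) : ℂ) * √(p i * w i s * z i t) = p i * w i s * z i t := by
    rw [← Complex.ofReal_mul, Real.mul_self_sqrt (mul_nonneg (mul_nonneg (hp i) (hw i s)) (hz i t))]
    push_cast
    rfl
  simp only [of_apply, star_mul', smul_eq_mul, Complex.star_def, Complex.conj_ofReal]
  linear_combination -(v i s x.1 * u i t x.2 * (starRingEnd ℂ) (v i s y.1) *
    (starRingEnd ℂ) (u i t y.2)) * hsq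

theorem eigs_eq {ι : Type*} [Fintype ι] [DecidableEq ι] {ρ : Matrix ι ι ℂ} (h : ρ.IsHermitian) :
    eigs ρ = h.eigenvalues := dif_pos h

theorem sum_eigs {ι : Type*} [Fintype ι] [DecidableEq ι] {ρ : Matrix ι ι ℂ} (h : ρ.IsHermitian) :
    ∑ i, eigs ρ i = ρ.trace.re := by
  rw [eigs_eq h, h.trace_eq_sum_eigenvalues]
  simp

theorem trace_ptrace2 {n m : ℕ} (ρ : Matrix (Fin n × Fin m) (Fin n × Fin m) ℂ) :
    (ptrace2 ρ).trace = ρ.trace := by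
  simp [trace, ptrace2, Fintype.sum_prod_type]

/-- **majorization criterion for separability.** Let `ρ` be a separable density
matrix on `ℂⁿ ⊗ ℂᵐ` with reduced state `ρ_A = Tr₂ ρ`. If `f` enumerates the eigenvalues of `ρ`
in decreasing order and `g` enumerates the eigenvalues of `ρ_A` (padded with zeros to the same
length `n·m`) in decreasing order, then every partial sum of `f` is bounded by the corresponding
partial sum of `g`, with equality for the full sums: the eigenvalue vector of `ρ` is majorized
by that of `ρ_A`. -/
theorem majorization_criterion {n m : ℕ} (ρ : Matrix (Fin n × Fin m) (Fin n × Fin m) ℂ)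
    (hρ : IsDensityMatrix ρ) (hsep : IsSeparableState ρ)
    (f g : Fin (n * m) → ℝ) (e : Fin (n * m) ≃ Fin n × Fin m)
    (hf : f = eigs ρ ∘ e) (hfa : Antitone f)
    (π : Equiv.Perm (Fin (n * m)))
    (hg : g = (fun i : Fin (n * m) =>
        if h : (i : ℕ) < n then eigs (ptrace2 ρ) ⟨(i : ℕ), h⟩ else 0) ∘ π)
    (hga : Antitone g) :
    (∀ k : ℕ, ∑ i ∈ Finset.univ.filter (fun i : Fin (n * m) => (i : ℕ) < k), f i
        ≤ ∑ i ∈ Finset.univ.filter (fun i : Fin (n * m) => (i : ℕ) < k), g i) ∧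
    ∑ i, f i = ∑ i, g i := by
  have hnm : n ≤ n * m := by
    rcases Nat.eq_zero_or_pos m with rfl | hm
    · simpa [trace] using hρ.2
    · exact Nat.le_mul_of_pos_right n hm
  obtain ⟨N, A, B, hB, hAB⟩ := hsep.exists_product_vectors
  have hρV : ρ = of (fun x j => A x.1 j * B x.2 j) * (of fun x j => A x.1 j * B x.2 j)ᴴ := by
    ext x y
    simp only [hAB, mul_apply, conjTranspose_apply, of_apply]
  have hρA : ptrace2 ρ = A * Aᴴ := by
    ext x y
    simp only [ptrace2, of_apply, hAB, mul_apply, conjTranspose_apply]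
    rw [Finset.sum_comm]
    refine Finset.sum_congr rfl fun j _ => ?_
    have hBj : ∑ k, B k j * star (B k j) = 1 := by
      simp only [Complex.star_def, Complex.mul_conj']
      exact_mod_cast hB j
    calc _ = A x j * star (A y j) * ∑ k, B k j * star (B k j) := by
          rw [Finset.mul_sum]
          exact Finset.sum_congr rfl fun k _ => by rw [star_mul']; ring
      _ = _ := by rw [hBj, mul_one]
  have hHρ := isHermitian_mul_conjTranspose_self (of fun (x : Fin n × Fin m) j => A x.1 j * B x.2 j)
  have hHA := isHermitian_mul_conjTranspose_self A
  obtain ⟨D, hD, hrow, hcol, hDl⟩ :=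
    exists_doubly_substochastic A B hB _ (fun _ _ => rfl) hHρ hHA
  have hfull : ∑ i, f i = ∑ i, g i := by
    rw [hf, hg]
    simp only [Function.comp_def]
    rw [Equiv.sum_comp e (eigs ρ), Equiv.sum_comp π fun i : Fin (n * m) =>
      if h : (i : ℕ) < n then eigs (ptrace2 ρ) ⟨(i : ℕ), h⟩ else 0, Fin.sum_dite_lt hnm,
      sum_eigs hρ.1.1, sum_eigs (hρA ▸ hHA), trace_ptrace2]
  refine ⟨sum_filter_lt_le_of_doubly_substochastic
    (fun i j => if h : (π j).val < n then D (e i) ⟨(π j).val, h⟩ else 0) f g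
    (fun i j => ?_) (fun i => ?_) (fun j => ?_) (fun j => ?_) hga (fun i => ?_), hfull⟩
  · split_ifs
    exacts [hD _ _, le_rfl]
  · rw [Equiv.sum_comp π fun j : Fin (n * m) =>
      if h : j.val < n then D (e i) ⟨j.val, h⟩ else 0, Fin.sum_dite_lt hnm]
    exact hrow _
  · split_ifs with h
    · rw [Equiv.sum_comp e fun r => D r ⟨(π j).val, h⟩]
      exact hcol _
    · simp
  · simp only [hg, Function.comp_apply, hρA, eigs_eq hHA]
    split_ifs
    exacts [(posSemidef_self_mul_conjTranspose A).eigenvalues_nonneg _, le_rfl]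
  · have hfi : f i = ∑ s, D (e i) s * eigs (ptrace2 ρ) s := by
      rw [hf, hρA, eigs_eq hHA, ← hDl]
      exact congrFun ((congrArg eigs hρV).trans (eigs_eq hHρ)) (e i)
    rw [hfi, ← Fin.sum_dite_lt hnm, ← Equiv.sum_comp π, hg]
    refine Finset.sum_congr rfl fun j _ => ?_
    simp only [Function.comp_apply]
    split_ifs <;> simp
end

section
/- (Entropic separability criterion.) Let ρ be a separable density matrix on ℂⁿ ⊗ ℂᵐ (indexed by Fin n × Fin m), with reduced states ρ_A = Tr₂(ρ) and ρ_B = Tr₁(ρ). Then the von Neumann entropy of the whole is at least that of each subsystem: S(ρ) ≥ S(ρ_A) and S(ρ) ≥ S(ρ_B). -/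
open Matrix
open scoped Kronecker ComplexOrder

/-- Jensen's inequality for `x ↦ -x log x` with weights of total mass at most one. -/
lemma sum_mul_negMulLog_le {κ : Type*} [Fintype κ] (w a : κ → ℝ) (hw : ∀ k, 0 ≤ w k)
    (hw1 : ∑ k, w k ≤ 1) (ha : ∀ k, 0 ≤ a k) :
    ∑ k, w k * Real.negMulLog (a k) ≤ Real.negMulLog (∑ k, w k * a k) := by
  have h := Real.concaveOn_negMulLog.le_map_sum (t := (Finset.univ : Finset (Option κ)))
    (w := fun o => o.elim (1 - ∑ k, w k) w) (p := fun o => o.elim 0 a)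
    (by rintro (_ | k) _ <;> simp [hw, hw1])
    (by simp [Fintype.sum_option])
    (by rintro (_ | k) _ <;> simp [ha])
  simpa [Fintype.sum_option] using h

/-- If `r = D a` with `D` doubly substochastic, `a ≥ 0`, and `r` and `a` have the same sum, then
the entropy of `r` is at least the entropy of `a`. -/
lemma sum_negMulLog_le_of_substochastic {κ γ : Type*} [Fintype κ] [Fintype γ] (D : γ → κ → ℝ)
    (a : κ → ℝ) (r : γ → ℝ) (hD : ∀ j k, 0 ≤ D j k) (hrow : ∀ j, ∑ k, D j k ≤ 1)
    (hcol : ∀ k, ∑ j, D j k ≤ 1) (ha : ∀ k, 0 ≤ a k) (hr : ∀ j, r j = ∑ k, D j k * a k)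
    (hsum : ∑ j, r j = ∑ k, a k) :
    ∑ k, Real.negMulLog (a k) ≤ ∑ j, Real.negMulLog (r j) := by
  have hzero : ∑ k, (1 - ∑ j, D j k) * a k = 0 := by
    simp only [sub_mul, one_mul, Finset.sum_sub_distrib, Finset.sum_mul]
    rw [Finset.sum_comm, ← hsum, sub_eq_zero]
    exact Finset.sum_congr rfl fun j _ => hr j
  have hk : ∀ k, (1 - ∑ j, D j k) * a k = 0 := fun k =>
    (Finset.sum_eq_zero_iff_of_nonneg
      fun k _ => mul_nonneg (sub_nonneg.2 (hcol k)) (ha k)).1 hzero k (Finset.mem_univ k)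
  calc ∑ k, Real.negMulLog (a k) = ∑ k, ∑ j, D j k * Real.negMulLog (a k) := by
        refine Finset.sum_congr rfl fun k _ => ?_
        rw [← Finset.sum_mul]
        rcases mul_eq_zero.1 (hk k) with h | h
        · rw [← sub_eq_zero.1 h, one_mul]
        · simp [h]
    _ = ∑ j, ∑ k, D j k * Real.negMulLog (a k) := Finset.sum_comm
    _ ≤ ∑ j, Real.negMulLog (r j) := Finset.sum_le_sum fun j _ => by
        rw [hr j]
        exact sum_mul_negMulLog_le _ _ (hD j) (hrow j) ha

lemma ofReal_sum_norm_sq {κ : Type*} [Fintype κ] (z : κ → ℂ) :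
    ((∑ k, ‖z k‖ ^ 2 : ℝ) : ℂ) = star z ⬝ᵥ z := by
  simp [dotProduct, Complex.conj_mul']

lemma sum_norm_sq_mulVec {γ κ : Type*} [Fintype γ] [Fintype κ] [DecidableEq κ]
    {F : Matrix γ κ ℂ} (hF : Fᴴ * F = 1) (z : κ → ℂ) :
    ∑ g, ‖(F *ᵥ z) g‖ ^ 2 = ∑ k, ‖z k‖ ^ 2 := by
  apply Complex.ofReal_injective
  rw [ofReal_sum_norm_sq, ofReal_sum_norm_sq, star_mulVec, dotProduct_mulVec, vecMul_vecMul, hF,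
    vecMul_one]

/-- Bessel's inequality for the columns of a partial isometry. -/
lemma sum_norm_sq_conjTranspose_mulVec_le {ι κ : Type*} [Fintype ι] [Fintype κ]
    {V : Matrix ι κ ℂ} (hV : V * Vᴴ * V = V) (w : ι → ℂ) :
    ∑ k, ‖(Vᴴ *ᵥ w) k‖ ^ 2 ≤ ∑ i, ‖w i‖ ^ 2 := by
  have hV' : Vᴴ * (V * Vᴴ) = Vᴴ := by
    simpa [conjTranspose_mul, Matrix.mul_assoc] using congrArg conjTranspose hV
  have h : ∑ i, ‖w i‖ ^ 2 - ∑ k, ‖(Vᴴ *ᵥ w) k‖ ^ 2 = ∑ i, ‖(w - V *ᵥ (Vᴴ *ᵥ w)) i‖ ^ 2 := by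
    apply Complex.ofReal_injective
    rw [Complex.ofReal_sub, ofReal_sum_norm_sq, ofReal_sum_norm_sq, ofReal_sum_norm_sq]
    simp only [star_sub, sub_dotProduct, dotProduct_sub, star_mulVec, conjTranspose_conjTranspose,
      dotProduct_mulVec, sub_vecMul, vecMul_vecMul, Matrix.mul_assoc, hV']
    simp
  have h0 : 0 ≤ ∑ i, ‖(w - V *ᵥ (Vᴴ *ᵥ w)) i‖ ^ 2 := by positivity
  linarith

lemma sum_norm_sq_transpose_mulVec_le {ι κ : Type*} [Fintype ι] [Fintype κ]
    {V : Matrix ι κ ℂ} (hV : V * Vᴴ * V = V) (w : ι → ℂ) :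
    ∑ k, ‖(Vᵀ *ᵥ w) k‖ ^ 2 ≤ ∑ i, ‖w i‖ ^ 2 := by
  have h := sum_norm_sq_conjTranspose_mulVec_le hV (star w)
  have e : ∀ k, ‖(Vᴴ *ᵥ star w) k‖ = ‖(Vᵀ *ᵥ w) k‖ := fun k => by
    rw [← norm_star ((Vᵀ *ᵥ w) k)]
    simp [mulVec, dotProduct]
  simpa [e] using h

/-- Singular value decomposition, with squared singular values the eigenvalues of `M * Mᴴ`. -/
lemma exists_svd {α ι : Type*} [Fintype α] [DecidableEq α] [Fintype ι] (M : Matrix α ι ℂ) :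
    ∃ (F : Matrix α α ℂ) (s : α → ℝ) (V : Matrix ι α ℂ), Fᴴ * F = 1 ∧
      (∀ k, s k ^ 2 = eigs (M * Mᴴ) k) ∧ V * Vᴴ * V = V ∧ (∀ k, ∑ i, ‖V i k‖ ^ 2 ≤ 1) ∧
      M = F * diagonal (fun k => (s k : ℂ)) * Vᴴ ∧
      M * V = F * diagonal (fun k => (s k : ℂ)) := by
  have hM : (M * Mᴴ).IsHermitian := isHermitian_mul_conjTranspose_self M
  have hps : (M * Mᴴ).PosSemidef := posSemidef_self_mul_conjTranspose M
  set a := hM.eigenvalues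
  have ha0 : ∀ k, 0 ≤ a k := hps.eigenvalues_nonneg
  set F : Matrix α α ℂ := hM.eigenvectorUnitary.1
  have hF : Fᴴ * F = 1 := Unitary.coe_star_mul_self hM.eigenvectorUnitary
  have hF' : F * Fᴴ = 1 := Unitary.coe_mul_star_self hM.eigenvectorUnitary
  have hspec : M * Mᴴ = F * diagonal (fun k => (a k : ℂ)) * Fᴴ := by
    have := hM.spectral_theorem
    rw [Unitary.conjStarAlgAut_apply] at this
    exact this
  set s : α → ℝ := fun k => √(a k)
  have hss : ∀ k, s k * s k = a k := fun k => Real.mul_self_sqrt (ha0 k)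
  set G : Matrix ι α ℂ := Mᴴ * F with hG
  have hGG : Gᴴ * G = diagonal (fun k => (a k : ℂ)) := by
    calc Gᴴ * G = Fᴴ * (M * Mᴴ) * F := by
          simp [hG, conjTranspose_mul, Matrix.mul_assoc]
      _ = (Fᴴ * F) * diagonal (fun k => (a k : ℂ)) * (Fᴴ * F) := by
          rw [hspec]; simp only [Matrix.mul_assoc]
      _ = _ := by rw [hF]; simp
  have hcol : ∀ k, ∑ i, ‖G i k‖ ^ 2 = a k := fun k => by
    apply Complex.ofReal_injective
    rw [ofReal_sum_norm_sq]
    have := congrFun (congrFun hGG k) k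
    simpa [mul_apply, dotProduct] using this
  have hGzero : ∀ i k, s k = 0 → G i k = 0 := fun i k hk => by
    have h1 := hcol k
    rw [← hss, hk, mul_zero, Finset.sum_eq_zero_iff_of_nonneg (fun _ _ => by positivity)] at h1
    simpa using h1 i (Finset.mem_univ i)
  set V : Matrix ι α ℂ := G * diagonal (fun k => ((s k)⁻¹ : ℂ)) with hVdef
  have hVs : V * diagonal (fun k => (s k : ℂ)) = G := by
    ext i k
    rw [mul_diagonal, hVdef, mul_diagonal]
    by_cases hk : s k = 0
    · simp [hGzero i k hk]
    · have : (s k : ℂ) ≠ 0 := by exact_mod_cast hk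
      field_simp
  have hVV : Vᴴ * V = diagonal (fun k => (s k : ℂ) * (s k : ℂ)⁻¹) := by
    calc Vᴴ * V = diagonal (fun k => ((s k)⁻¹ : ℂ)) * (Gᴴ * G) *
          diagonal (fun k => ((s k)⁻¹ : ℂ)) := by
          rw [hVdef, conjTranspose_mul, diagonal_conjTranspose]
          simp only [Matrix.mul_assoc]
          congr 2
          ext k
          simp
      _ = _ := by
          rw [hGG, diagonal_mul_diagonal, diagonal_mul_diagonal]
          congr 1
          ext k
          rw [← hss]
          push_cast
          by_cases hk : s k = 0
          · simp [hk]
          · have : (s k : ℂ) ≠ 0 := by exact_mod_cast hk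
            field_simp
  have hMV : M = F * diagonal (fun k => (s k : ℂ)) * Vᴴ := by
    have h1 : Gᴴ = diagonal (fun k => (s k : ℂ)) * Vᴴ := by
      rw [← hVs, conjTranspose_mul, diagonal_conjTranspose]
      congr 2
      ext k
      simp
    rw [Matrix.mul_assoc, ← h1, hG, conjTranspose_mul, conjTranspose_conjTranspose,
      ← Matrix.mul_assoc, hF', Matrix.one_mul]
  refine ⟨F, s, V, hF, fun k => ?_, ?_, fun k => ?_, hMV, ?_⟩
  · rw [sq, hss, eigs, dif_pos hM]
  · rw [Matrix.mul_assoc, hVV]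
    ext i k
    rw [mul_diagonal, hVdef, mul_diagonal]
    by_cases hk : s k = 0
    · simp [hk]
    · have : (s k : ℂ) ≠ 0 := by exact_mod_cast hk
      field_simp
  · have h1 : ∑ i, ‖V i k‖ ^ 2 = s k * (s k)⁻¹ := by
      apply Complex.ofReal_injective
      rw [ofReal_sum_norm_sq]
      have := congrFun (congrFun hVV k) k
      simpa [mul_apply, dotProduct] using this
    rw [h1]
    exact mul_inv_le_one
  · conv_lhs => rw [hMV]
    rw [Matrix.mul_assoc, hVV, Matrix.mul_assoc, diagonal_mul_diagonal]
    congr 2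
    ext k
    by_cases hk : s k = 0
    · simp [hk]
    · have : (s k : ℂ) ≠ 0 := by exact_mod_cast hk
      field_simp

lemma vnEntropy_eq_sum_negMulLog {α : Type*} [Fintype α] [DecidableEq α] (ρ : Matrix α α ℂ) :
    vnEntropy ρ = ∑ k, Real.negMulLog (eigs ρ k) := by
  simp [vnEntropy, Real.negMulLog]

lemma sum_eigs_mul_conjTranspose {α ι : Type*} [Fintype α] [DecidableEq α] [Fintype ι]
    (M : Matrix α ι ℂ) : ∑ k, eigs (M * Mᴴ) k = ∑ i, ∑ a, ‖M a i‖ ^ 2 := by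
  have hM : (M * Mᴴ).IsHermitian := isHermitian_mul_conjTranspose_self M
  apply Complex.ofReal_injective
  have h := hM.trace_eq_sum_eigenvalues
  rw [eigs, dif_pos hM]
  push_cast
  rw [Finset.sum_comm]
  refine h.symm.trans ?_
  simp [trace, mul_apply, Complex.mul_conj']

/-- If the columns of `R` are product vectors `x ⊗ y` with `x` a column of `X` and `y` a unit
vector, then `R * Rᴴ` has at least the entropy of `X * Xᴴ`. -/
lemma vnEntropy_mul_conjTranspose_le {α β γ ι : Type*} [Fintype α] [DecidableEq α] [Fintype β]
    [Fintype γ] [DecidableEq γ] [Fintype ι] (e : γ ≃ α × β) (X : Matrix α ι ℂ) (y : ι → β → ℂ)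
    (R : Matrix γ ι ℂ) (hy : ∀ i, ∑ b, ‖y i b‖ ^ 2 = 1)
    (hR : ∀ g i, R g i = X (e g).1 i * y i (e g).2) :
    vnEntropy (X * Xᴴ) ≤ vnEntropy (R * Rᴴ) := by
  obtain ⟨F, s, V, hF, hs, hV, hV1, hX, -⟩ := exists_svd X
  obtain ⟨E, t, U, hE, ht, hU, hU1, -, hRU⟩ := exists_svd R
  rw [vnEntropy_eq_sum_negMulLog, vnEntropy_eq_sum_negMulLog]
  have hmass : ∀ u : ι → ℂ, ∑ b, ∑ i, ‖y i b * u i‖ ^ 2 = ∑ i, ‖u i‖ ^ 2 := fun u => by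
    rw [Finset.sum_comm]
    simp [mul_pow, ← Finset.sum_mul, hy]
  have hsum : ∀ f : α → β → ℝ, ∑ g, f (e g).1 (e g).2 = ∑ b, ∑ a, f a b := fun f => by
    rw [e.sum_comp (fun p => f p.1 p.2), Fintype.sum_prod_type, Finset.sum_comm]
  refine sum_negMulLog_le_of_substochastic
    (fun j k => ∑ b, ‖∑ i, star (V i k) * (y i b * U i j)‖ ^ 2) _ _
    (fun j k => by positivity) (fun j => ?_) (fun k => ?_)
    (fun k => by rw [← hs]; positivity) (fun j => ?_) ?_
  · rw [Finset.sum_comm]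
    refine le_trans (Finset.sum_le_sum fun b _ =>
      sum_norm_sq_conjTranspose_mulVec_le hV fun i => y i b * U i j) ?_
    rw [hmass]
    exact hU1 j
  · rw [Finset.sum_comm]
    have h : ∀ b j, ∑ i, star (V i k) * (y i b * U i j) =
        (Uᵀ *ᵥ fun i => y i b * star (V i k)) j := fun b j =>
      Finset.sum_congr rfl fun i _ => by
        change _ = U i j * (y i b * star (V i k))
        ring
    simp only [h]
    refine le_trans (Finset.sum_le_sum fun b _ =>
      sum_norm_sq_transpose_mulVec_le hU fun i => y i b * star (V i k)) ?_
    rw [hmass fun i => star (V i k)]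
    simpa using hV1 k
  · have h1 : eigs (R * Rᴴ) j = ∑ g, ‖(R * U) g j‖ ^ 2 := by
      have h2 : ∀ g, (R * U) g j = (E *ᵥ Pi.single j (t j : ℂ)) g := fun g => by
        rw [hRU, mul_diagonal]
        simp [mulVec]
      simp only [h2]
      rw [sum_norm_sq_mulVec hE, Finset.sum_eq_single j]
      · simp [ht]
      · intro k _ hk
        simp [hk]
      · simp
    have h3 : ∀ g, (R * U) g j = (F *ᵥ fun k =>
        (s k : ℂ) * ∑ i, star (V i k) * (y i (e g).2 * U i j)) (e g).1 := fun g => by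
      have h4 : (R * U) g j = (X *ᵥ fun i => y i (e g).2 * U i j) (e g).1 := by
        simp [mul_apply, mulVec, dotProduct, hR, mul_assoc]
      rw [h4, hX, ← mulVec_mulVec, ← mulVec_mulVec]
      congr 2
      ext k
      rw [mulVec_diagonal]
      rfl
    rw [h1]
    simp only [h3]
    rw [hsum fun a b => ‖(F *ᵥ fun k =>
        (s k : ℂ) * ∑ i, star (V i k) * (y i b * U i j)) a‖ ^ 2]
    simp only [sum_norm_sq_mulVec hF, norm_mul, mul_pow, Finset.sum_mul, ← hs]
    rw [Finset.sum_comm]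
    simp [mul_comm]
  · rw [sum_eigs_mul_conjTranspose, sum_eigs_mul_conjTranspose]
    refine Finset.sum_congr rfl fun i _ => ?_
    simp only [hR]
    rw [hsum fun a b => ‖X a i * y i b‖ ^ 2, Finset.sum_comm]
    simp [mul_pow, ← Finset.mul_sum, hy]

/-- A density matrix is a mixture of pure states: it is `∑ₖ wₖ |vₖ⟩⟨vₖ|` with unit `vₖ`. -/
lemma IsDensityMatrix.exists_pure_decomposition {α : Type*} [Fintype α] [DecidableEq α]
    {σ : Matrix α α ℂ} (hσ : IsDensityMatrix σ) :
    ∃ (w : α → ℝ) (v : α → α → ℂ), (∀ k, 0 ≤ w k) ∧ ∑ k, w k = 1 ∧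
      (∀ k, ∑ a, ‖v k a‖ ^ 2 = 1) ∧ ∀ a b, σ a b = ∑ k, w k * (v k a * star (v k b)) := by
  have hM := hσ.1.isHermitian
  refine ⟨hM.eigenvalues, fun k a => (hM.eigenvectorUnitary : Matrix α α ℂ) a k,
    hσ.1.eigenvalues_nonneg, ?_, fun k => ?_, fun a b => ?_⟩
  · apply Complex.ofReal_injective
    have h := hM.trace_eq_sum_eigenvalues
    rw [hσ.2] at h
    simpa using h.symm
  · apply Complex.ofReal_injective
    rw [ofReal_sum_norm_sq]
    have h := congrFun (congrFun (Unitary.coe_star_mul_self hM.eigenvectorUnitary) k) k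
    simpa [mul_apply, dotProduct, star_apply] using h
  · have h := hM.spectral_theorem
    rw [Unitary.conjStarAlgAut_apply] at h
    conv_lhs => rw [h]
    rw [mul_apply]
    refine Finset.sum_congr rfl fun k _ => ?_
    rw [mul_diagonal, star_apply]
    simp only [Function.comp_apply, Complex.coe_algebraMap]
    ring

/-- A separable state is a sum of projections onto product vectors `x ⊗ y`, where `c` carries the
weight of each term. -/
lemma IsSeparableState.exists_pure_decomposition {n m : ℕ}
    {ρ : Matrix (Fin n × Fin m) (Fin n × Fin m) ℂ} (h : IsSeparableState ρ) :
    ∃ (N : ℕ) (c : Fin N × Fin n × Fin m → ℝ) (x : Fin N × Fin n × Fin m → Fin n → ℂ)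
      (y : Fin N × Fin n × Fin m → Fin m → ℂ),
      (∀ i, ∑ a, ‖x i a‖ ^ 2 = 1) ∧ (∀ i, ∑ b, ‖y i b‖ ^ 2 = 1) ∧
      ∀ a b a' b', ρ (a, b) (a', b') =
        ∑ i, (c i * x i a * y i b) * star (c i * x i a' * y i b') := by
  obtain ⟨N, p, σ, τ, hp, -, hσ, hτ, rfl⟩ := h
  choose w v hw _ hv hσv using fun i => (hσ i).exists_pure_decomposition
  choose w' v' hw' _ hv' hτv using fun i => (hτ i).exists_pure_decomposition
  refine ⟨N, fun i => √(p i.1 * w i.1 i.2.1 * w' i.1 i.2.2), fun i => v i.1 i.2.1,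
    fun i => v' i.1 i.2.2, fun i => hv _ _, fun i => hv' _ _, fun a b a' b' => ?_⟩
  simp only [Matrix.sum_apply, Matrix.smul_apply, kroneckerMap_apply, hσv, hτv, smul_eq_mul,
    Fintype.sum_prod_type]
  refine Finset.sum_congr rfl fun i _ => ?_
  rw [Finset.sum_mul_sum]
  simp only [Finset.mul_sum]
  refine Finset.sum_congr rfl fun k _ =>
    Finset.sum_congr rfl fun l _ => ?_
  have hc : ((√(p i * w i k * w' i l) : ℝ) : ℂ) * (√(p i * w i k * w' i l) : ℝ) =
      p i * w i k * w' i l := by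
    rw [← Complex.ofReal_mul,
      Real.mul_self_sqrt (mul_nonneg (mul_nonneg (hp i) (hw i k)) (hw' i l))]
    push_cast
    rfl
  simp only [star_mul', Complex.star_def, Complex.conj_ofReal]
  linear_combination (-(v i k a * v' i l b * (starRingEnd ℂ) (v i k a') *
    (starRingEnd ℂ) (v' i l b'))) * hc

lemma sum_mul_mul_star_mul {ι β : Type*} [Fintype ι] [Fintype β] (u u' : ι → ℂ) (y : ι → β → ℂ)
    (hy : ∀ i, ∑ b, ‖y i b‖ ^ 2 = 1) :
    ∑ b, ∑ i, (u i * y i b) * star (u' i * y i b) = ∑ i, u i * star (u' i) := by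
  rw [Finset.sum_comm]
  refine Finset.sum_congr rfl fun i _ => ?_
  have h : ∑ b, y i b * star (y i b) = 1 := by
    have h := congrArg (fun r : ℝ => (r : ℂ)) (hy i)
    simpa [Complex.mul_conj'] using h
  rw [← mul_one (u i * star (u' i)), ← h, Finset.mul_sum]
  refine Finset.sum_congr rfl fun b _ => ?_
  rw [star_mul']
  ring

/-- **entropic separability criterion.** If `ρ` is a separable density matrix on
`ℂⁿ ⊗ ℂᵐ` with reduced states `ρ_A = Tr₂ ρ` and `ρ_B = Tr₁ ρ`, then the von Neumann entropy of
the whole is at least that of each subsystem: `S(ρ) ≥ S(ρ_A)` and `S(ρ) ≥ S(ρ_B)`. -/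
theorem entropic_separability_criterion {n m : ℕ}
    (ρ : Matrix (Fin n × Fin m) (Fin n × Fin m) ℂ)
    (hρ : IsDensityMatrix ρ) (hsep : IsSeparableState ρ) :
    vnEntropy (ptrace2 ρ) ≤ vnEntropy ρ ∧ vnEntropy (ptrace1 ρ) ≤ vnEntropy ρ := by
  obtain ⟨N, c, x, y, hx, hy, hρxy⟩ := hsep.exists_pure_decomposition
  set R : Matrix (Fin n × Fin m) (Fin N × Fin n × Fin m) ℂ :=
    of fun g i => c i * x i g.1 * y i g.2 with hR
  have hρR : ρ = R * Rᴴ := by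
    ext ⟨a, b⟩ ⟨a', b'⟩
    rw [hρxy]
    simp [hR, mul_apply]
  constructor
  · have hA : ptrace2 ρ = (of fun a i => c i * x i a) * (of fun a i => c i * x i a)ᴴ := by
      ext a a'
      simp only [ptrace2, of_apply, hρxy]
      rw [sum_mul_mul_star_mul (fun i => c i * x i a) (fun i => c i * x i a') y hy]
      simp [mul_apply]
    rw [hA, hρR]
    exact vnEntropy_mul_conjTranspose_le (Equiv.refl _) _ y R hy fun _ _ => rfl
  · have hB : ptrace1 ρ = (of fun b i => c i * y i b) * (of fun b i => c i * y i b)ᴴ := by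
      ext b b'
      simp only [ptrace1, of_apply, hρxy, mul_right_comm _ (x _ _) (y _ _)]
      rw [sum_mul_mul_star_mul (fun i => c i * y i b) (fun i => c i * y i b') x hx]
      simp [mul_apply]
    rw [hB, hρR]
    exact vnEntropy_mul_conjTranspose_le (Equiv.prodComm _ _) _ x R hx
      fun _ _ => mul_right_comm _ _ _
end
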